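/- arXiv:2204.11607 — 4 statements merged into one kernel-verified Lean document; each statement's English description precedes it below -/
import Mathlib

section
/- Let m ≥ 1 be an integer and α ∈ [1,∞). Then there is a constant C = C(m,α) such that for all ν ≥ 1 the sum Φ_{m,α,ν} = Σ_{x ∈ Δ_{m,α,ν} ∩ ℤ^m} (x_1 + ⋯ + x_{m−1} + α·x_m) satisfies |Φ_{m,α,ν} − ν^{m+1}/(α·(m+1)·(m−1)!)| ≤ C·ν^m. -/
/-- The sum of `(ν - w · x) ^ p` over the points `x` with coordinates in `{0, …, K - 1}` that
satisfy `w · x ≤ ν`. -/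
noncomputable def simplexPowSum {m : ℕ} (K p : ℕ) (w : Fin m → ℝ) (ν : ℝ) : ℝ :=
  ∑ x : Fin m → Fin K,
    if ∑ i, w i * ((x i : ℕ) : ℝ) ≤ ν then (ν - ∑ i, w i * ((x i : ℕ) : ℝ)) ^ p else 0

theorem succ_mul_pow_mul_sub_le {s t : ℝ} (hs : 0 ≤ s) (hst : s ≤ t) (q : ℕ) :
    ((q : ℝ) + 1) * s ^ q * (t - s) ≤ t ^ (q + 1) - s ^ (q + 1) := by
  induction q with
  | zero => simp
  | succ q ih =>
    have h1 : s * (((q : ℝ) + 1) * s ^ q * (t - s)) ≤ t * (t ^ (q + 1) - s ^ (q + 1)) :=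
      mul_le_mul hst ih (mul_nonneg (by positivity) (sub_nonneg.2 hst)) (hs.trans hst)
    push_cast
    linear_combination h1

theorem pow_sub_pow_le_succ_mul {s t : ℝ} (hs : 0 ≤ s) (hst : s ≤ t) (q : ℕ) :
    t ^ (q + 1) - s ^ (q + 1) ≤ ((q : ℝ) + 1) * t ^ q * (t - s) := by
  induction q with
  | zero => simp
  | succ q ih =>
    have ht := hs.trans hst
    have h1 := mul_le_mul_of_nonneg_left ih ht
    have h2 : s ^ (q + 1) * (t - s) ≤ t ^ (q + 1) * (t - s) :=
      mul_le_mul_of_nonneg_right (by gcongr) (sub_nonneg.2 hst)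
    push_cast
    linear_combination h1 + h2

theorem sum_range_ite_eq_zero {w ν : ℝ} (hw : 0 < w) (hν : ν < 0) (K : ℕ) (f : ℝ → ℝ) :
    ∑ j ∈ Finset.range K, (if w * (j : ℝ) ≤ ν then f (ν - w * j) else 0) = 0 := by
  refine Finset.sum_eq_zero fun j _ => if_neg ?_
  have : 0 ≤ w * (j : ℝ) := by positivity
  linarith

theorem sum_range_succ_ite_eq {w ν : ℝ} (hν : 0 ≤ ν) (K : ℕ) (f : ℝ → ℝ) :
    ∑ j ∈ Finset.range (K + 1), (if w * (j : ℝ) ≤ ν then f (ν - w * j) else 0) =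
      (∑ j ∈ Finset.range K, (if w * (j : ℝ) ≤ ν - w then f (ν - w - w * j) else 0)) + f ν := by
  rw [Finset.sum_range_succ']
  congr 1
  · refine Finset.sum_congr rfl fun j _ => ?_
    have h1 : w * ((j + 1 : ℕ) : ℝ) ≤ ν ↔ w * (j : ℝ) ≤ ν - w := by
      push_cast
      constructor <;> intro h <;> linarith
    have h2 : ν - w * ((j + 1 : ℕ) : ℝ) = ν - w - w * j := by
      push_cast
      ring
    simp only [h1, h2]
  · simp [hν]

theorem pow_succ_le_sum_range {w : ℝ} (hw : 0 < w) (q K : ℕ) {ν : ℝ} (hν : 0 ≤ ν)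
    (hK : ν < w * K) :
    ν ^ (q + 1) ≤ ((q : ℝ) + 1) * w *
      ∑ j ∈ Finset.range K, (if w * (j : ℝ) ≤ ν then (ν - w * j) ^ q else 0) := by
  induction K generalizing ν with
  | zero => simp at hK; linarith
  | succ K ih =>
    rw [sum_range_succ_ite_eq hν K (fun t => t ^ q)]
    rcases lt_or_ge ν w with h | h
    · rw [sum_range_ite_eq_zero hw (sub_neg.2 h) K (fun t => t ^ q), zero_add, pow_succ]
      have h1 : ν ≤ ((q : ℝ) + 1) * w := by nlinarith [(Nat.cast_nonneg q : (0 : ℝ) ≤ q)]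
      have := mul_le_mul_of_nonneg_left h1 (pow_nonneg hν q)
      linarith
    · have h1 := ih (sub_nonneg.2 h) (by push_cast at hK; linarith)
      have h2 := pow_sub_pow_le_succ_mul (sub_nonneg.2 h) (sub_le_self ν hw.le) q
      rw [mul_add]
      linear_combination h1 + h2

theorem sum_range_le_pow_succ {w s : ℝ} (hw : 0 < w) (hs : 0 ≤ s) (q K : ℕ) {ν : ℝ} (hν : 0 ≤ ν) :
    ((q : ℝ) + 1) * w *
      ∑ j ∈ Finset.range K, (if w * (j : ℝ) ≤ ν then (ν - w * j + s) ^ q else 0) ≤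
      (ν + s + w) ^ (q + 1) := by
  induction K generalizing ν with
  | zero => simp; positivity
  | succ K ih =>
    rw [sum_range_succ_ite_eq hν K (fun t => (t + s) ^ q)]
    have h2 := succ_mul_pow_mul_sub_le (add_nonneg hν hs) (le_add_of_nonneg_right hw.le) q
    rcases lt_or_ge ν w with h | h
    · rw [sum_range_ite_eq_zero hw (sub_neg.2 h) K (fun t => (t + s) ^ q), zero_add]
      have h3 : 0 ≤ (ν + s) ^ (q + 1) := by positivity
      linear_combination h2 + h3
    · have h1 := ih (sub_nonneg.2 h)
      rw [show ν - w + s + w = ν + s by ring] at h1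
      rw [mul_add]
      linear_combination h1 + h2

theorem simplexPowSum_of_neg {m : ℕ} (K p : ℕ) {w : Fin m → ℝ} (hw : ∀ i, 0 < w i) {ν : ℝ}
    (hν : ν < 0) : simplexPowSum K p w ν = 0 := by
  refine Finset.sum_eq_zero fun x _ => if_neg ?_
  have : 0 ≤ ∑ i, w i * ((x i : ℕ) : ℝ) :=
    Finset.sum_nonneg fun i _ => mul_nonneg (hw i).le (Nat.cast_nonneg _)
  linarith

theorem simplexPowSum_succ {m : ℕ} (K p : ℕ) {w : Fin (m + 1) → ℝ} (hw : ∀ i, 0 < w i) (ν : ℝ) :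
    simplexPowSum K p w ν = ∑ j ∈ Finset.range K,
      if w 0 * (j : ℝ) ≤ ν then simplexPowSum K p (fun i => w i.succ) (ν - w 0 * j) else 0 := by
  have h : ∀ j : ℕ, (if w 0 * (j : ℝ) ≤ ν then
      simplexPowSum K p (fun i => w i.succ) (ν - w 0 * j) else 0) =
      simplexPowSum K p (fun i => w i.succ) (ν - w 0 * j) := by
    intro j
    split_ifs with hj
    · rfl
    · exact (simplexPowSum_of_neg K p (fun i => hw i.succ) (by linarith)).symm
  simp only [h]
  rw [Finset.sum_range, simplexPowSum,
    ← (Fin.consEquiv fun _ : Fin (m + 1) => Fin K).sum_comp, Fintype.sum_prod_type]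
  refine Finset.sum_congr rfl fun j _ => Finset.sum_congr rfl fun y _ => ?_
  have h3 : ∑ i, w i * (((Fin.consEquiv fun _ : Fin (m + 1) => Fin K) (j, y) i : ℕ) : ℝ) =
      w 0 * ((j : ℕ) : ℝ) + ∑ i : Fin m, w i.succ * ((y i : ℕ) : ℝ) := by
    simp [Fin.sum_univ_succ, Fin.consEquiv]
  rw [h3]
  simp only [le_sub_iff_add_le', sub_sub]

theorem pow_le_simplexPowSum {m : ℕ} (K p : ℕ) {w : Fin m → ℝ} (hw : ∀ i, 0 < w i) {ν : ℝ}
    (hν : 0 ≤ ν) (hK : ∀ i, ν < w i * K) :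
    (p.factorial : ℝ) * ν ^ (m + p) ≤
      ((m + p).factorial : ℝ) * (∏ i, w i) * simplexPowSum K p w ν := by
  induction m generalizing ν with
  | zero => simp [simplexPowSum, hν]
  | succ m ih =>
    rw [simplexPowSum_succ K p hw, Fin.prod_univ_succ, show m + 1 + p = m + p + 1 by ring,
      Nat.factorial_succ]
    have h1 := mul_le_mul_of_nonneg_left (pow_succ_le_sum_range (hw 0) (m + p) K hν (hK 0))
      (Nat.cast_nonneg p.factorial : (0 : ℝ) ≤ p.factorial)
    have h2 : (p.factorial : ℝ) * ∑ j ∈ Finset.range K,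
          (if w 0 * (j : ℝ) ≤ ν then (ν - w 0 * j) ^ (m + p) else 0) ≤
        ((m + p).factorial : ℝ) * (∏ i : Fin m, w i.succ) * ∑ j ∈ Finset.range K,
          (if w 0 * (j : ℝ) ≤ ν then
            simplexPowSum K p (fun i => w i.succ) (ν - w 0 * j) else 0) := by
      rw [Finset.mul_sum, Finset.mul_sum]
      refine Finset.sum_le_sum fun j _ => ?_
      split_ifs with hj
      · refine ih (fun i => hw i.succ) (sub_nonneg.2 hj) fun i => ?_
        have := mul_nonneg (hw 0).le (Nat.cast_nonneg j : (0 : ℝ) ≤ j)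
        linarith [hK i.succ]
      · simp
    have h3 := mul_le_mul_of_nonneg_left h2
      (mul_nonneg (by positivity : (0 : ℝ) ≤ ((m + p : ℕ) : ℝ) + 1) (hw 0).le)
    push_cast at h1 h3 ⊢
    linear_combination h1 + h3

theorem simplexPowSum_le_pow {m : ℕ} (K p : ℕ) {w : Fin m → ℝ} (hw : ∀ i, 0 < w i) {ν : ℝ}
    (hν : 0 ≤ ν) :
    ((m + p).factorial : ℝ) * (∏ i, w i) * simplexPowSum K p w ν ≤
      (p.factorial : ℝ) * (ν + ∑ i, w i) ^ (m + p) := by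
  induction m generalizing ν with
  | zero => simp [simplexPowSum, hν]
  | succ m ih =>
    rw [simplexPowSum_succ K p hw, Fin.prod_univ_succ, show m + 1 + p = m + p + 1 by ring,
      Nat.factorial_succ, Fin.sum_univ_succ]
    have hs : 0 ≤ ∑ i : Fin m, w i.succ := Finset.sum_nonneg fun i _ => (hw i.succ).le
    have h1 := mul_le_mul_of_nonneg_left (sum_range_le_pow_succ (hw 0) hs (m + p) K hν)
      (Nat.cast_nonneg p.factorial : (0 : ℝ) ≤ p.factorial)
    have h2 : ((m + p).factorial : ℝ) * (∏ i : Fin m, w i.succ) * ∑ j ∈ Finset.range K,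
          (if w 0 * (j : ℝ) ≤ ν then
            simplexPowSum K p (fun i => w i.succ) (ν - w 0 * j) else 0) ≤
        (p.factorial : ℝ) * ∑ j ∈ Finset.range K,
          (if w 0 * (j : ℝ) ≤ ν then
            (ν - w 0 * j + ∑ i : Fin m, w i.succ) ^ (m + p) else 0) := by
      rw [Finset.mul_sum, Finset.mul_sum]
      refine Finset.sum_le_sum fun j _ => ?_
      split_ifs with hj
      · exact ih (fun i => hw i.succ) (sub_nonneg.2 hj)
      · simp
    have h3 := mul_le_mul_of_nonneg_left h2
      (mul_nonneg (by positivity : (0 : ℝ) ≤ ((m + p : ℕ) : ℝ) + 1) (hw 0).le)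
    rw [show ν + (w 0 + ∑ i : Fin m, w i.succ) = ν + ∑ i : Fin m, w i.succ + w 0 by ring]
    push_cast at h1 h3 ⊢
    linear_combination h1 + h3

theorem add_pow_succ_sub_pow_le {s ν : ℝ} (hs : 0 ≤ s) (hν : 1 ≤ ν) (q : ℕ) :
    (ν + s) ^ (q + 1) - ν ^ (q + 1) ≤ ((q : ℝ) + 1) * s * (1 + s) ^ q * ν ^ q := by
  have h1 := pow_sub_pow_le_succ_mul (by linarith : 0 ≤ ν) (le_add_of_nonneg_right hs) q
  have h2 : (ν + s) ^ q ≤ (1 + s) ^ q * ν ^ q := by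
    rw [← mul_pow]
    gcongr
    nlinarith
  have h3 := mul_le_mul_of_nonneg_left h2 (mul_nonneg (by positivity : (0 : ℝ) ≤ (q : ℝ) + 1) hs)
  linear_combination h1 + h3

theorem finsum_mem_simplex_eq {m : ℕ} (K : ℕ) {w : Fin m → ℝ} (hw : ∀ i, 0 < w i) {ν : ℝ}
    (hK : ∀ i, ν < w i * K) :
    ∑ᶠ x ∈ {x : Fin m → ℤ | (∀ i, 0 ≤ x i) ∧ ∑ i, w i * (x i : ℝ) ≤ ν}, ∑ i, w i * (x i : ℝ) =
      ν * simplexPowSum K 0 w ν - simplexPowSum K 1 w ν := by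
  have himage : {x : Fin m → ℤ | (∀ i, 0 ≤ x i) ∧ ∑ i, w i * (x i : ℝ) ≤ ν} =
      (fun (y : Fin m → Fin K) i => ((y i : ℕ) : ℤ)) ''
        {y | ∑ i, w i * ((y i : ℕ) : ℝ) ≤ ν} := by
    ext x
    constructor
    · rintro ⟨h0, hx⟩
      have hlt : ∀ i, (x i).toNat < K := by
        intro i
        have h1 : w i * (x i : ℝ) ≤ ∑ i, w i * (x i : ℝ) :=
          Finset.single_le_sum (f := fun i => w i * (x i : ℝ))
            (fun i _ => mul_nonneg (hw i).le (by exact_mod_cast h0 i)) (Finset.mem_univ i)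
        have h2 : (x i : ℝ) < K := lt_of_mul_lt_mul_left ((h1.trans hx).trans_lt (hK i)) (hw i).le
        have h3 : x i < K := by exact_mod_cast h2
        have := h0 i
        omega
      have hcast : ∀ i, (((x i).toNat : ℕ) : ℤ) = x i := fun i => Int.toNat_of_nonneg (h0 i)
      refine ⟨fun i => ⟨(x i).toNat, hlt i⟩, ?_, funext hcast⟩
      have hcast' : ∀ i, (((x i).toNat : ℕ) : ℝ) = x i := fun i => by exact_mod_cast hcast i
      simpa [hcast'] using hx
    · rintro ⟨y, hy, rfl⟩
      exact ⟨fun i => Int.natCast_nonneg _, by simpa using hy⟩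
  have hinj : Function.Injective (fun (y : Fin m → Fin K) i => ((y i : ℕ) : ℤ)) := by
    intro y z h
    funext i
    exact Fin.ext (Nat.cast_injective (R := ℤ) (congrFun h i))
  rw [himage, finsum_mem_image hinj.injOn, finsum_mem_eq_toFinset_sum, simplexPowSum,
    simplexPowSum, Finset.mul_sum, ← Finset.sum_sub_distrib, Set.toFinset_ofPred,
    Finset.sum_filter]
  refine Finset.sum_congr rfl fun y _ => ?_
  split_ifs <;> simp

theorem abs_finsum_mem_simplex_sub_le {m : ℕ} {w : Fin (m + 1) → ℝ} (hw : ∀ i, 1 ≤ w i) :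
    ∃ C : ℝ, ∀ ν : ℝ, 1 ≤ ν →
      |∑ᶠ x ∈ {x : Fin (m + 1) → ℤ | (∀ i, 0 ≤ x i) ∧ ∑ i, w i * (x i : ℝ) ≤ ν},
          ∑ i, w i * (x i : ℝ) -
        ν ^ (m + 2) / ((∏ i, w i) * ((m : ℝ) + 2) * (m.factorial : ℝ))| ≤ C * ν ^ (m + 1) := by
  have hw0 : ∀ i, 0 < w i := fun i => zero_lt_one.trans_le (hw i)
  set W := ∏ i, w i with hW
  set s := ∑ i, w i with hs
  have hWpos : 0 < W := Finset.prod_pos fun i _ => hw0 i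
  have hspos : 0 ≤ s := Finset.sum_nonneg fun i _ => (hw0 i).le
  refine ⟨(((m : ℝ) + 1) * s * (1 + s) ^ m) / (((m + 1).factorial : ℝ) * W) +
    (((m + 1 : ℕ) : ℝ) + 1) * s * (1 + s) ^ (m + 1) / (((m + 2).factorial : ℝ) * W),
    fun ν hν => ?_⟩
  have hν0 : 0 ≤ ν := zero_le_one.trans hν
  obtain ⟨K, hKν⟩ := exists_nat_gt ν
  have hK : ∀ i, ν < w i * K := fun i =>
    hKν.trans_le (le_mul_of_one_le_left (Nat.cast_nonneg K) (hw i))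
  rw [finsum_mem_simplex_eq K hw0 hK]
  have l0 := pow_le_simplexPowSum K 0 hw0 hν0 hK
  have u0 := simplexPowSum_le_pow K 0 hw0 hν0
  have l1 := pow_le_simplexPowSum K 1 hw0 hν0 hK
  have u1 := simplexPowSum_le_pow K 1 hw0 hν0
  have e0 := add_pow_succ_sub_pow_le hspos hν m
  have e1 := add_pow_succ_sub_pow_le hspos hν (m + 1)
  rw [← hW] at l0 u0 l1 u1
  rw [← hs] at u0 u1
  simp only [add_zero, Nat.factorial_zero, Nat.factorial_one, Nat.cast_one, one_mul,
    show m + 1 + 1 = m + 2 from rfl] at l0 u0 l1 u1 e0 e1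
  set A := ((m + 1).factorial : ℝ) * W with hA
  set B := ((m + 2).factorial : ℝ) * W with hB
  have hApos : 0 < A := by positivity
  have hBpos : 0 < B := by positivity
  set N := simplexPowSum K 0 w ν
  set G := simplexPowSum K 1 w ν
  set a := ((m : ℝ) + 1) * s * (1 + s) ^ m
  set b := (((m + 1 : ℕ) : ℝ) + 1) * s * (1 + s) ^ (m + 1)
  have hN1 : 0 ≤ N - ν ^ (m + 1) / A := by
    rw [sub_nonneg, div_le_iff₀ hApos]; linarith
  have hN2 : N - ν ^ (m + 1) / A ≤ a / A * ν ^ m := by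
    rw [show N - ν ^ (m + 1) / A = (A * N - ν ^ (m + 1)) / A by field_simp, div_mul_eq_mul_div]
    gcongr
    linarith
  have hG1 : 0 ≤ G - ν ^ (m + 2) / B := by
    rw [sub_nonneg, div_le_iff₀ hBpos]; linarith
  have hG2 : G - ν ^ (m + 2) / B ≤ b / B * ν ^ (m + 1) := by
    rw [show G - ν ^ (m + 2) / B = (B * G - ν ^ (m + 2)) / B by field_simp, div_mul_eq_mul_div]
    gcongr
    linarith
  have hmain : ν ^ (m + 2) / (W * ((m : ℝ) + 2) * (m.factorial : ℝ)) =
      ν * (ν ^ (m + 1) / A) - ν ^ (m + 2) / B := by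
    rw [hA, hB, Nat.factorial_succ (m + 1), Nat.factorial_succ m]
    push_cast
    field_simp
    ring
  have hN3 := mul_nonneg hν0 hN1
  have hN4 := mul_le_mul_of_nonneg_left hN2 hν0
  have hN5 : ν * (a / A * ν ^ m) = a / A * ν ^ (m + 1) := by ring
  rw [hmain, abs_le]
  constructor <;> linarith

theorem statement8 (m : ℕ) (hm : 1 ≤ m) (α : ℝ) (hα : 1 ≤ α) :
    ∃ C : ℝ, ∀ ν : ℝ, 1 ≤ ν →
      |(∑ᶠ x ∈ {x : Fin m → ℤ | (∀ i, 0 ≤ x i) ∧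
            (∑ i, (x i : ℝ)) + (α - 1) * ((x ⟨m - 1, by omega⟩ : ℤ) : ℝ) ≤ ν},
            ((∑ i, (x i : ℝ)) + (α - 1) * ((x ⟨m - 1, by omega⟩ : ℤ) : ℝ)))
          - ν ^ (m + 1) / (α * ((m : ℝ) + 1) * ((m - 1).factorial : ℝ))| ≤ C * ν ^ m := by
  obtain ⟨n, rfl⟩ : ∃ n, m = n + 1 := ⟨m - 1, by omega⟩
  set w : Fin (n + 1) → ℝ := fun i => if i = Fin.last n then α else 1 with hwdef
  have hw : ∀ i, 1 ≤ w i := by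
    intro i
    simp only [hwdef]
    split_ifs <;> linarith
  have hprod : ∏ i, w i = α := by simp [hwdef]
  have hlast : ∀ h : n + 1 - 1 < n + 1, (⟨n + 1 - 1, h⟩ : Fin (n + 1)) = Fin.last n :=
    fun _ => rfl
  have hsum : ∀ x : Fin (n + 1) → ℤ,
      ∑ i, (x i : ℝ) + (α - 1) * (x (Fin.last n) : ℝ) = ∑ i, w i * (x i : ℝ) := by
    intro x
    simp only [hwdef, Fin.sum_univ_castSucc, (Fin.castSucc_lt_last _).ne, if_false, if_true,
      one_mul]
    ring
  obtain ⟨C, hC⟩ := abs_finsum_mem_simplex_sub_le hw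
  refine ⟨C, fun ν hν => ?_⟩
  have h := hC ν hν
  rw [hprod] at h
  simp only [hlast, hsum]
  rw [show ((n + 1 : ℕ) : ℝ) + 1 = (n : ℝ) + 2 by push_cast; ring]
  exact h
end

section
/- Let F ∈ ℤ[X,Y] be a binary form of degree d ≥ 2 with a(F) ≤ d/2. Then there is a constant c_d depending only on d such that for every rank-two sublattice Λ ⊆ ℤ², every real B ≥ 2 and every real P ≥ 1, the number N_F(Λ,B,P) of primitive integer points x ∈ Λ with ‖x‖_∞ ≤ B and 1 ≤ |F(x)| ≤ P satisfies N_F(Λ,B,P) ≤ c_d·(P^{2/d}/det(Λ) + 1)·log B. In particular, taking Λ = ℤ², the number N_F(B,P) of primitive x ∈ ℤ² with ‖x‖_∞ ≤ B and 1 ≤ |F(x)| ≤ P satisfies N_F(B,P) ≤ c_d·P^{2/d}·log B (with c_d adjusted by an absolute factor). -/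
open MvPolynomial

/-- The complex linear binary form with coefficient vector `l`. -/
noncomputable def linForm (l : Fin 2 → ℂ) : MvPolynomial (Fin 2) ℂ :=
  MvPolynomial.C (l 0) * MvPolynomial.X 0 + MvPolynomial.C (l 1) * MvPolynomial.X 1

/-- `a(F) ≤ d/2`: every non-zero complex linear form divides `F` (over `ℂ`) with
multiplicity at most `d/2`. -/
def MultiplicityLEHalf (F : MvPolynomial (Fin 2) ℤ) (d : ℕ) : Prop :=
  ∀ (l : Fin 2 → ℂ) (e : ℕ), l ≠ 0 →
    (linForm l) ^ e ∣ MvPolynomial.map (Int.castRingHom ℂ) F → 2 * e ≤ d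

theorem index_le_natAbs_det (Λ : Submodule ℤ (Fin 2 → ℤ)) {u v : Fin 2 → ℤ}
    (hu : u ∈ Λ) (hv : v ∈ Λ) (h : u 0 * v 1 - u 1 * v 0 ≠ 0) :
    Λ.toAddSubgroup.index ≤ (u 0 * v 1 - u 1 * v 0).natAbs := by
  have hdet : (Matrix.of ![u, v]).det = u 0 * v 1 - u 1 * v 0 := by
    simp [Matrix.det_fin_two, mul_comm]
  have hli : LinearIndependent ℤ ![u, v] := by
    have := Matrix.linearIndependent_rows_of_det_ne_zero (A := Matrix.of ![u, v]) (by rwa [hdet])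
    exact this
  have hidx := Submodule.natAbs_det_basis_change (Pi.basisFun ℤ (Fin 2))
    (Submodule.span ℤ (Set.range ![u, v])) (Module.Basis.span hli)
  have hb : ((↑) ∘ (Module.Basis.span hli) : Fin 2 → Fin 2 → ℤ) = ![u, v] :=
    funext fun i ↦ congrArg Subtype.val (Module.Basis.span_apply hli i)
  rw [hb, Pi.basisFun_det_apply, hdet] at hidx
  have hle : (Submodule.span ℤ (Set.range ![u, v])).toAddSubgroup ≤ Λ.toAddSubgroup := by
    have : Submodule.span ℤ (Set.range ![u, v]) ≤ Λ := by
      rw [Submodule.span_le]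
      rintro _ ⟨i, rfl⟩
      fin_cases i <;> simpa
    exact this
  have hdvd := AddSubgroup.index_dvd_of_le hle
  rw [hidx]
  exact Nat.le_of_dvd (hidx ▸ Int.natAbs_pos.mpr h) hdvd

/-- Primitive integer vectors on a common line through the origin agree up to sign. -/
theorem eq_of_det_eq_zero {u v : Fin 2 → ℤ} (hu : Int.gcd (u 0) (u 1) = 1)
    (hv : Int.gcd (v 0) (v 1) = 1) (h : u 0 * v 1 - u 1 * v 0 = 0)
    (hs : 0 < u 1 * v 1) : u = v := by
  have h1 : u 1 ∣ v 1 := by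
    refine (Int.isCoprime_iff_gcd_eq_one.mpr hu).symm.dvd_of_dvd_mul_left ⟨v 0, ?_⟩
    linarith
  have h2 : v 1 ∣ u 1 := by
    refine (Int.isCoprime_iff_gcd_eq_one.mpr hv).symm.dvd_of_dvd_mul_left ⟨u 0, ?_⟩
    linarith
  have h3 : u 1 = v 1 := by
    rcases Int.natAbs_eq_natAbs_iff.mp (Int.natAbs_eq_of_dvd_dvd h1 h2) with h' | h'
    · exact h'
    · rw [h'] at hs
      nlinarith [sq_nonneg (v 1)]
  have h4 : v 1 ≠ 0 := by
    rintro h0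
    simp [h0] at hs
  have h5 : u 0 = v 0 := by
    apply mul_right_cancel₀ h4
    rw [h3] at h
    linarith
  ext i
  fin_cases i
  · exact h5
  · exact h3

theorem card_le_of_slope_near (Λ : Submodule ℤ (Fin 2 → ℤ)) (hΛ : Λ.toAddSubgroup.index ≠ 0)
    (S : Finset (Fin 2 → ℤ)) (z r A : ℝ) (hA : 0 < A)
    (hr : 0 ≤ r)
    (hS : ∀ x ∈ S, x ∈ Λ ∧ Int.gcd (x 0) (x 1) = 1 ∧ x 1 ≠ 0 ∧ |(x 1 : ℝ)| ≤ A ∧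
      |(x 0 : ℝ) / x 1 - z| ≤ r) :
    (S.card : ℝ) ≤ 2 * (2 * r * A ^ 2 / Λ.toAddSubgroup.index + 1) := by
  set N : ℕ := Λ.toAddSubgroup.index
  have hN : (0 : ℝ) < N := by positivity
  set w : (Fin 2 → ℤ) → ℝ := fun x ↦ ((x 0 : ℝ) / x 1 - z + r) * (A ^ 2 / N) with hw
  set M : ℕ := ⌊2 * r * A ^ 2 / N⌋₊ with hM
  have hw0 : ∀ x ∈ S, 0 ≤ w x := fun x hx ↦ by
    have := (abs_le.mp (hS x hx).2.2.2.2).1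
    exact mul_nonneg (by linarith) (by positivity)
  have hw1 : ∀ x ∈ S, w x ≤ 2 * r * A ^ 2 / N := fun x hx ↦ by
    have := (abs_le.mp (hS x hx).2.2.2.2).2
    rw [mul_div_assoc]
    exact mul_le_mul_of_nonneg_right (by linarith) (by positivity)
  have hcard : S.card ≤ ((Finset.univ : Finset Bool) ×ˢ Finset.range (M + 1)).card := by
    refine Finset.card_le_card_of_injOn (fun x ↦ (decide (0 < x 1), ⌊w x⌋₊)) ?_ ?_
    · intro x hx
      simp only [Finset.coe_product, Finset.coe_univ, Set.mem_prod, Set.mem_univ, true_and,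
        Finset.coe_range, Set.mem_Iio]
      exact Nat.lt_succ_of_le (Nat.floor_le_floor (hw1 x hx))
    · intro x hx y hy hxy
      simp only [Prod.mk.injEq, decide_eq_decide] at hxy
      obtain ⟨hsign, hfl⟩ := hxy
      obtain ⟨hxΛ, hxg, hx0, hxA, -⟩ := hS x hx
      obtain ⟨hyΛ, hyg, hy0, hyA, -⟩ := hS y hy
      have hpos : 0 < x 1 * y 1 := by
        rcases lt_or_gt_of_ne hx0 with h | h
        · have : y 1 < 0 := by
            refine lt_of_le_of_ne (not_lt.mp fun h' ↦ ?_) hy0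
            exact absurd (hsign.mpr h') (by linarith)
          exact mul_pos_of_neg_of_neg h this
        · exact mul_pos h (hsign.mp h)
      refine eq_of_det_eq_zero hxg hyg ?_ hpos
      by_contra hdet
      have hle := index_le_natAbs_det Λ hxΛ hyΛ hdet
      have hle' : (N : ℝ) ≤ |(x 0 * y 1 - x 1 * y 0 : ℝ)| := by
        have : (N : ℤ) ≤ |x 0 * y 1 - x 1 * y 0| := by
          rw [Int.abs_eq_natAbs]
          exact_mod_cast hle
        exact_mod_cast this
      have hlt : |w x - w y| < 1 := by
        have h1 := Nat.floor_le (hw0 x hx)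
        have h2 := Nat.lt_floor_add_one (w x)
        have h3 := Nat.floor_le (hw0 y hy)
        have h4 := Nat.lt_floor_add_one (w y)
        rw [hfl] at h1 h2
        rw [abs_lt]
        constructor <;> linarith
      have hx0' : (x 1 : ℝ) ≠ 0 := by exact_mod_cast hx0
      have hy0' : (y 1 : ℝ) ≠ 0 := by exact_mod_cast hy0
      have heq : (x 0 * y 1 - x 1 * y 0 : ℝ) * A ^ 2 = (w x - w y) * N * (x 1 * y 1) := by
        simp only [hw]
        field_simp
        ring
      have habs : |(x 0 * y 1 - x 1 * y 0 : ℝ)| * A ^ 2 = |w x - w y| * N * (|(x 1 : ℝ)| * |(y 1 : ℝ)|) := by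
        have := congrArg abs heq
        simpa [abs_mul, abs_of_pos hA] using this
      have hprod : |(x 1 : ℝ)| * |(y 1 : ℝ)| ≤ A ^ 2 := by
        rw [sq]
        exact mul_le_mul hxA hyA (abs_nonneg _) hA.le
      have hA2 : 0 < A ^ 2 := by positivity
      have hxy0 : 0 < |(x 1 : ℝ)| * |(y 1 : ℝ)| := by positivity
      have : |w x - w y| * N * (|(x 1 : ℝ)| * |(y 1 : ℝ)|) < 1 * N * A ^ 2 := by
        calc _ < 1 * N * (|(x 1 : ℝ)| * |(y 1 : ℝ)|) := by gcongr
          _ ≤ _ := by gcongr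
      rw [← habs] at this
      nlinarith [mul_le_mul_of_nonneg_right hle' hA2.le]
  have hcard' : S.card ≤ 2 * (M + 1) := by simpa using hcard
  have hMle : (M : ℝ) ≤ 2 * r * A ^ 2 / N := Nat.floor_le (by positivity)
  calc (S.card : ℝ) ≤ ((2 * (M + 1) : ℕ) : ℝ) := by exact_mod_cast hcard'
    _ = 2 * ((M : ℝ) + 1) := by push_cast; ring
    _ ≤ _ := by linarith

/-- The restriction of a binary form to the line through `(r, s)` with direction `(p, q)`. -/
noncomputable def restrictLine {R : Type*} [CommRing R] (F : MvPolynomial (Fin 2) R)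
    (p q r s : R) : Polynomial R :=
  aeval ![Polynomial.C p * Polynomial.X + Polynomial.C r,
    Polynomial.C q * Polynomial.X + Polynomial.C s] F

/-- The substitution `X ↦ p X + r Y`, `Y ↦ q X + s Y`. -/
noncomputable def linSubst {R : Type*} [CommRing R] (p q r s : R) :
    MvPolynomial (Fin 2) R →ₐ[R] MvPolynomial (Fin 2) R :=
  aeval ![C p * X 0 + C r * X 1, C q * X 0 + C s * X 1]

theorem linSubst_isHomogeneous {R : Type*} [CommRing R] {F : MvPolynomial (Fin 2) R} {d : ℕ}
    (hF : F.IsHomogeneous d) (p q r s : R) : (linSubst p q r s F).IsHomogeneous d := by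
  have h := hF.aeval (n := 1)
    (![C p * X 0 + C r * X 1, C q * X 0 + C s * X 1] : Fin 2 → MvPolynomial (Fin 2) R) (fun i ↦ by
    fin_cases i
    · exact (isHomogeneous_C_mul_X _ _).add (isHomogeneous_C_mul_X _ _)
    · exact (isHomogeneous_C_mul_X _ _).add (isHomogeneous_C_mul_X _ _))
  rw [one_mul] at h
  exact h

theorem aeval_X_one_linSubst {R : Type*} [CommRing R] (F : MvPolynomial (Fin 2) R)
    (p q r s : R) : aeval ![Polynomial.X, 1] (linSubst p q r s F) = restrictLine F p q r s := by
  have : (aeval ![Polynomial.X, (1 : Polynomial R)]).comp (linSubst p q r s) =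
      aeval ![Polynomial.C p * Polynomial.X + Polynomial.C r,
        Polynomial.C q * Polynomial.X + Polynomial.C s] := by
    apply MvPolynomial.algHom_ext
    intro i
    fin_cases i <;> simp [linSubst, Polynomial.C_eq_algebraMap]
  exact congrArg (fun f ↦ f F) this

theorem linSubst_linSubst_of_det {R : Type*} [CommRing R] (F : MvPolynomial (Fin 2) R)
    {p q r s : R} (h : p * s - q * r = 1) :
    linSubst s (-q) (-r) p (linSubst p q r s F) = F := by
  have h' : (C p * C s - C q * C r : MvPolynomial (Fin 2) R) = 1 := by
    simp only [← C_mul, ← C_sub, h, C_1]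
  have : (linSubst s (-q) (-r) p).comp (linSubst p q r s) = AlgHom.id R _ := by
    apply MvPolynomial.algHom_ext
    intro i
    fin_cases i
    · simp [linSubst, MvPolynomial.algebraMap_eq]
      linear_combination X 0 * h'
    · simp [linSubst, MvPolynomial.algebraMap_eq]
      linear_combination X 1 * h'
  exact congrArg (fun f ↦ f F) this

theorem homogenize_restrictLine {R : Type*} [CommRing R] {F : MvPolynomial (Fin 2) R} {d : ℕ}
    (hF : F.IsHomogeneous d) (p q r s : R) :
    (restrictLine F p q r s).homogenize d = linSubst p q r s F :=
  Polynomial.homogenize_eq_of_isHomogeneous (linSubst_isHomogeneous hF p q r s)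
    (aeval_X_one_linSubst F p q r s)

theorem restrictLine_ne_zero {R : Type*} [CommRing R] {F : MvPolynomial (Fin 2) R} {d : ℕ}
    (hF : F.IsHomogeneous d) (hF0 : F ≠ 0) {p q r s : R} (h : p * s - q * r = 1) :
    restrictLine F p q r s ≠ 0 := by
  intro h0
  have h1 := homogenize_restrictLine hF p q r s
  rw [h0, Polynomial.homogenize_zero] at h1
  apply hF0
  rw [← linSubst_linSubst_of_det F h, ← h1, map_zero]

theorem natDegree_restrictLine_le {R : Type*} [CommRing R] {F : MvPolynomial (Fin 2) R} {d : ℕ}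
    (hF : F.IsHomogeneous d) (p q r s : R) : (restrictLine F p q r s).natDegree ≤ d := by
  rw [restrictLine, F.as_sum, map_sum]
  refine Polynomial.natDegree_sum_le_of_forall_le _ _ fun m hm ↦ ?_
  have hm' : m 0 + m 1 = d := by
    have := hF (mem_support_iff.mp hm)
    rw [Finsupp.weight_apply, Finsupp.sum_fintype _ _ (by simp)] at this
    simpa using this
  rw [aeval_monomial, Finsupp.prod_fintype _ _ (by simp)]
  simp only [Fin.prod_univ_two, Matrix.cons_val_zero, Matrix.cons_val_one]
  rw [← Polynomial.C_eq_algebraMap]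
  refine (Polynomial.natDegree_C_mul_le _ _).trans (Polynomial.natDegree_mul_le.trans ?_)
  rw [← hm']
  refine add_le_add ?_ ?_ <;>
  · refine Polynomial.natDegree_pow_le.trans ?_
    exact (Nat.mul_le_mul_left _ Polynomial.natDegree_linear_le).trans (by simp)

/-- If no linear form divides `F` more than `d / 2` times, then the restriction of `F` to an
affine line through a unimodular pair of vectors has degree at least `d / 2`. -/
theorem le_two_mul_natDegree_restrictLine {F : MvPolynomial (Fin 2) ℤ} {d : ℕ}
    (hF : F.IsHomogeneous d) (hm : MultiplicityLEHalf F d) {p q r s : ℤ}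
    (h : p * s - q * r = 1) : d ≤ 2 * (restrictLine F p q r s).natDegree := by
  set g := restrictLine F p q r s with hg
  have hle : g.natDegree ≤ d := natDegree_restrictLine_le hF p q r s
  have hdvd : (X 1 : MvPolynomial (Fin 2) ℤ) ^ (d - g.natDegree) ∣ linSubst p q r s F := by
    rw [← homogenize_restrictLine hF, ← hg]
    have := Polynomial.homogenize_mul g 1 (m := g.natDegree) (n := d - g.natDegree) le_rfl
      (by simp)
    rw [mul_one, Nat.add_sub_cancel' hle, Polynomial.homogenize_one] at this
    exact this ▸ Dvd.intro_left _ rfl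
  have hdvd' := map_dvd (linSubst s (-q) (-r) p) hdvd
  rw [linSubst_linSubst_of_det F h, map_pow] at hdvd'
  have hdvd'' := map_dvd (MvPolynomial.map (Int.castRingHom ℂ)) hdvd'
  have hl : MvPolynomial.map (Int.castRingHom ℂ) (linSubst s (-q) (-r) p (X 1)) =
      linForm ![-(q : ℂ), p] := by
    simp [linSubst, linForm]
  rw [map_pow, hl] at hdvd''
  have hne : (![-(q : ℂ), p] : Fin 2 → ℂ) ≠ 0 := by
    intro h0
    have h1 : (q : ℂ) = 0 := by simpa using congrFun h0 0
    have h2 : (p : ℂ) = 0 := by simpa using congrFun h0 1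
    have h1' : q = 0 := by exact_mod_cast h1
    have h2' : p = 0 := by exact_mod_cast h2
    simp [h1', h2'] at h
  have := hm _ _ hne hdvd''
  omega

theorem homogenize_prod_X_sub_C {R : Type*} [CommRing R] (n : ℕ) (t : Multiset R) :
    ((t.map fun α ↦ Polynomial.X - Polynomial.C α).prod).homogenize (t.card + n) =
      (t.map fun α ↦ (X 0 - C α * X 1 : MvPolynomial (Fin 2) R)).prod * X 1 ^ n := by
  nontriviality R
  induction t using Multiset.induction_on with
  | empty => simp
  | cons α t ih =>
    rw [Multiset.map_cons, Multiset.prod_cons, Multiset.card_cons, Multiset.map_cons,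
      Multiset.prod_cons, mul_assoc, ← ih, show t.card + 1 + n = 1 + (t.card + n) by ring,
      Polynomial.homogenize_mul]
    · simp
    · simp
    · rw [Polynomial.natDegree_multiset_prod_X_sub_C_eq_card]
      omega

/-- The dehomogenisation of an integral form, over `ℂ`. -/
noncomputable def dehom (F : MvPolynomial (Fin 2) ℤ) : Polynomial ℂ :=
  aeval ![Polynomial.X, 1] (MvPolynomial.map (Int.castRingHom ℂ) F)

theorem natDegree_dehom_le {F : MvPolynomial (Fin 2) ℤ} {d : ℕ} (hF : F.IsHomogeneous d) :
    (dehom F).natDegree ≤ d := by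
  have := natDegree_restrictLine_le (hF.map (Int.castRingHom ℂ)) 1 0 0 1
  simpa [restrictLine, dehom] using this

theorem map_eq_prod {F : MvPolynomial (Fin 2) ℤ} {d : ℕ} (hF : F.IsHomogeneous d) :
    MvPolynomial.map (Int.castRingHom ℂ) F = C (dehom F).leadingCoeff *
      (((dehom F).roots.map fun α ↦ (X 0 - C α * X 1 : MvPolynomial (Fin 2) ℂ)).prod *
        X 1 ^ (d - (dehom F).roots.card)) := by
  have hsplit := IsAlgClosed.splits (dehom F)
  have hcard : (dehom F).roots.card ≤ d :=
    (Polynomial.card_roots' _).trans (natDegree_dehom_le hF)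
  have h1 : (dehom F).homogenize d = MvPolynomial.map (Int.castRingHom ℂ) F :=
    Polynomial.homogenize_eq_of_isHomogeneous (hF.map _) rfl
  have h2 : dehom F = Polynomial.C (dehom F).leadingCoeff *
      ((dehom F).roots.map fun α ↦ Polynomial.X - Polynomial.C α).prod :=
    hsplit.eq_prod_roots
  rw [← homogenize_prod_X_sub_C, Nat.add_sub_cancel' hcard, ← Polynomial.homogenize_C_mul, ← h2, h1]

theorem norm_eval_dehom (F : MvPolynomial (Fin 2) ℤ) (z : ℂ) :
    ‖(dehom F).eval z‖ = ‖(dehom F).leadingCoeff‖ *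
      ((dehom F).roots.map fun α ↦ ‖z - α‖).prod := by
  rw [(IsAlgClosed.splits (dehom F)).eval_eq_prod_roots, norm_mul]
  congr 1
  have h := map_multiset_prod (normHom : ℂ →*₀ ℝ) ((dehom F).roots.map fun α ↦ z - α)
  rwa [Multiset.map_map] at h

/-- Coefficientwise domination of a complex polynomial by a real one. -/
def CoeffLE (p : Polynomial ℂ) (q : Polynomial ℝ) : Prop := ∀ i, ‖p.coeff i‖ ≤ q.coeff i

theorem CoeffLE.mul {p p' : Polynomial ℂ} {q q' : Polynomial ℝ} (h : CoeffLE p q)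
    (h' : CoeffLE p' q') : CoeffLE (p * p') (q * q') := by
  intro i
  rw [Polynomial.coeff_mul, Polynomial.coeff_mul]
  refine (norm_sum_le _ _).trans (Finset.sum_le_sum fun x _ ↦ ?_)
  rw [norm_mul]
  exact mul_le_mul (h _) (h' _) (norm_nonneg _) ((norm_nonneg _).trans (h _))

theorem CoeffLE.pow {p : Polynomial ℂ} {q : Polynomial ℝ} (h : CoeffLE p q) (n : ℕ) :
    CoeffLE (p ^ n) (q ^ n) := by
  induction n with
  | zero =>
    intro i
    simp only [pow_zero, Polynomial.coeff_one]
    split_ifs <;> simp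
  | succ n ih =>
    rw [pow_succ, pow_succ]
    exact ih.mul h

theorem CoeffLE.prod_map {ι : Type*} {t : Multiset ι} {f : ι → Polynomial ℂ}
    {g : ι → Polynomial ℝ} (h : ∀ a ∈ t, CoeffLE (f a) (g a)) :
    CoeffLE (t.map f).prod (t.map g).prod := by
  induction t using Multiset.induction_on with
  | empty =>
    intro i
    simp only [Multiset.map_zero, Multiset.prod_zero, Polynomial.coeff_one]
    split_ifs <;> simp
  | cons a t ih =>
    simp only [Multiset.map_cons, Multiset.prod_cons]
    exact (h a (by simp)).mul (ih fun b hb ↦ h b (by simp [hb]))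

theorem coeffLE_linear {a b : ℂ} {a' b' : ℝ} (ha : ‖a‖ ≤ a') (hb : ‖b‖ ≤ b') :
    CoeffLE (Polynomial.C a * Polynomial.X + Polynomial.C b)
      (Polynomial.C a' * Polynomial.X + Polynomial.C b') := by
  intro i
  rcases i with _ | _ | i <;> simp [Polynomial.coeff_X, Polynomial.coeff_C, ha, hb]

theorem coeffLE_C (a : ℂ) : CoeffLE (Polynomial.C a) (Polynomial.C ‖a‖) := by
  intro i
  simp only [Polynomial.coeff_C]
  split_ifs <;> simp

theorem coeff_linear_pow (a b : ℝ) (n i : ℕ) (hi : i ≤ n) :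
    ((Polynomial.C a * Polynomial.X + Polynomial.C b) ^ n).coeff i =
      a ^ i * b ^ (n - i) * n.choose i := by
  rw [add_pow, Polynomial.finsetSum_coeff, Finset.sum_eq_single i]
  · rw [mul_pow, ← Polynomial.C_pow, ← Polynomial.C_pow, ← Polynomial.C_eq_natCast,
      Polynomial.coeff_mul_C, Polynomial.coeff_mul_C, Polynomial.coeff_C_mul_X_pow, if_pos rfl]
  · intro j _ hj
    rw [mul_pow, ← Polynomial.C_pow, ← Polynomial.C_pow, ← Polynomial.C_eq_natCast,
      Polynomial.coeff_mul_C, Polynomial.coeff_mul_C, Polynomial.coeff_C_mul_X_pow,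
      if_neg hj.symm]
    simp
  · intro h
    exact absurd (Finset.mem_range.mpr (by omega)) h

theorem coeffLE_restrictLine {F : MvPolynomial (Fin 2) ℤ} {d : ℕ} (hF : F.IsHomogeneous d)
    {z l A B : ℝ} (hl : 0 < l) (hz : ∀ α ∈ (dehom F).roots, l ≤ ‖(z : ℂ) - α‖) {p q r s : ℤ}
    (hA : |(p : ℝ) - z * q| + l * |(q : ℝ)| ≤ A) (hB : |(r : ℝ) - z * s| + l * |(s : ℝ)| ≤ B) :
    CoeffLE ((restrictLine F p q r s).map (Int.castRingHom ℂ))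
      (Polynomial.C (‖(dehom F).eval (z : ℂ)‖ / l ^ d) *
        (Polynomial.C A * Polynomial.X + Polynomial.C B) ^ d) := by
  set t := (dehom F).roots with ht
  have hcard : t.card ≤ d := (Polynomial.card_roots' _).trans (natDegree_dehom_le hF)
  have hmap : (restrictLine F p q r s).map (Int.castRingHom ℂ) =
      Polynomial.C (dehom F).leadingCoeff *
        ((t.map fun α ↦ Polynomial.C ((p : ℂ) - α * q) * Polynomial.X +
          Polynomial.C ((r : ℂ) - α * s)).prod *
        (Polynomial.C (q : ℂ) * Polynomial.X + Polynomial.C (s : ℂ)) ^ (d - t.card)) := by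
    have h1 : (restrictLine F p q r s).map (Int.castRingHom ℂ) =
        restrictLine (MvPolynomial.map (Int.castRingHom ℂ) F) (p : ℂ) q r s := by
      rw [restrictLine, restrictLine, ← Polynomial.coe_mapRingHom, MvPolynomial.aeval_def,
        MvPolynomial.aeval_def, MvPolynomial.hom_eval₂, MvPolynomial.eval₂_map]
      congr 1
      · ext
        simp
      · ext i
        fin_cases i <;> simp
    rw [h1, map_eq_prod hF, restrictLine, map_mul, map_mul, map_pow, ← ht]
    congr 1
    · simp [Polynomial.C_eq_algebraMap]
    · congr 1
      · rw [map_multiset_prod, Multiset.map_map]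
        congr 1
        refine Multiset.map_congr rfl fun α _ ↦ ?_
        simp only [Function.comp, map_sub, map_mul, aeval_X, aeval_C, Matrix.cons_val_zero,
          Matrix.cons_val_one, ← Polynomial.C_eq_algebraMap]
        ring
      · simp
  have hbound : ∀ {m n : ℤ} {E : ℝ}, |(m : ℝ) - z * n| + l * |(n : ℝ)| ≤ E →
      ‖(n : ℂ)‖ ≤ 1 / l * E ∧ ∀ α ∈ t, ‖(m : ℂ) - α * n‖ ≤ ‖(z : ℂ) - α‖ / l * E := by
    intro m n E hE
    have hn : ‖(n : ℂ)‖ = |(n : ℝ)| := by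
      rw [← Complex.ofReal_intCast, Complex.norm_real, Real.norm_eq_abs]
    constructor
    · rw [hn, one_div, inv_mul_eq_div, le_div_iff₀ hl]
      nlinarith [abs_nonneg ((m : ℝ) - z * n)]
    · intro α hα
      have h1 : (m : ℂ) - α * n = (((m : ℝ) - z * n : ℝ) : ℂ) + ((z : ℂ) - α) * n := by
        push_cast
        ring
      have h2 := hz α hα
      calc ‖(m : ℂ) - α * n‖ ≤ |(m : ℝ) - z * n| + ‖(z : ℂ) - α‖ * |(n : ℝ)| := by
            rw [h1]
            refine (norm_add_le _ _).trans ?_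
            rw [Complex.norm_real, Real.norm_eq_abs, norm_mul, hn]
        _ ≤ ‖(z : ℂ) - α‖ / l * |(m : ℝ) - z * n| + ‖(z : ℂ) - α‖ * |(n : ℝ)| := by
            have : 1 ≤ ‖(z : ℂ) - α‖ / l := by rwa [one_le_div hl]
            nlinarith [abs_nonneg ((m : ℝ) - z * n)]
        _ = ‖(z : ℂ) - α‖ / l * (|(m : ℝ) - z * n| + l * |(n : ℝ)|) := by
            field_simp
        _ ≤ _ := by gcongr
  obtain ⟨hA1, hA2⟩ := hbound hA
  obtain ⟨hB1, hB2⟩ := hbound hB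
  have hprod : Polynomial.C (‖(dehom F).eval (z : ℂ)‖ / l ^ d) *
        (Polynomial.C A * Polynomial.X + Polynomial.C B) ^ d =
      Polynomial.C ‖(dehom F).leadingCoeff‖ *
        ((t.map fun α ↦ Polynomial.C (‖(z : ℂ) - α‖ / l * A) * Polynomial.X +
          Polynomial.C (‖(z : ℂ) - α‖ / l * B)).prod *
        (Polynomial.C (1 / l * A) * Polynomial.X + Polynomial.C (1 / l * B)) ^ (d - t.card)) := by
    have h1 : ∀ c : ℝ, Polynomial.C (c * A) * Polynomial.X + Polynomial.C (c * B) =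
        Polynomial.C c * (Polynomial.C A * Polynomial.X + Polynomial.C B) := fun c ↦ by
      simp only [map_mul]
      ring
    simp only [h1]
    rw [Multiset.prod_map_mul, mul_pow, Multiset.map_const', Multiset.prod_replicate,
      ← Polynomial.C_pow]
    have h2 : (t.map fun α ↦ Polynomial.C (‖(z : ℂ) - α‖ / l)).prod =
        Polynomial.C ((t.map fun α ↦ ‖(z : ℂ) - α‖).prod / l ^ t.card) := by
      rw [← Multiset.prod_replicate, ← Multiset.map_const', ← Multiset.prod_map_div,
        map_multiset_prod, Multiset.map_map]
      rfl
    rw [h2, norm_eval_dehom, ← ht]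
    have h3 : ‖(dehom F).leadingCoeff‖ * (t.map fun α ↦ ‖(z : ℂ) - α‖).prod / l ^ d =
        ‖(dehom F).leadingCoeff‖ * ((t.map fun α ↦ ‖(z : ℂ) - α‖).prod / l ^ t.card) *
          (1 / l) ^ (d - t.card) := by
      have : l ^ d = l ^ t.card * l ^ (d - t.card) := by
        rw [← pow_add, Nat.add_sub_cancel' hcard]
      rw [this, one_div, inv_pow]
      field_simp
    have h4 : (Polynomial.C A * Polynomial.X + Polynomial.C B) ^ d =
        (Polynomial.C A * Polynomial.X + Polynomial.C B) ^ t.card *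
          (Polynomial.C A * Polynomial.X + Polynomial.C B) ^ (d - t.card) := by
      rw [← pow_add, Nat.add_sub_cancel' hcard]
    rw [h3, h4]
    simp only [map_mul]
    ring
  rw [hmap, hprod]
  refine (coeffLE_C _).mul (CoeffLE.mul ?_ ?_)
  · exact CoeffLE.prod_map fun α hα ↦ coeffLE_linear (hA2 α hα) (hB2 α hα)
  · exact (coeffLE_linear hA1 hB1).pow _

theorem exists_int_mul_le_of_abs_le {a b e f l : ℝ} (hl : 0 < l) (h : |a * f - b * e| = l)
    (ha : |a| ^ 2 ≤ l) (hba : |b| ≤ |a|) :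
    ∃ k : ℤ, (|a| + |b|) * (|e + k * a| + |f + k * b|) ≤ 6 * l := by
  have ha0 : a ≠ 0 := by
    rintro rfl
    have : b = 0 := by simpa using hba
    simp [this] at h
    linarith
  refine ⟨-round (e / a), ?_⟩
  set k : ℝ := ((-round (e / a) : ℤ) : ℝ) with hk
  have h1 : |e + k * a| ≤ |a| := by
    have h2 : e + k * a = (e / a - round (e / a)) * a := by
      rw [hk]
      push_cast
      field_simp
      ring
    rw [h2, abs_mul]
    have := abs_sub_round (e / a)
    nlinarith [abs_nonneg a]
  have h3 : |a| * |f + k * b| ≤ l + |b| * |e + k * a| := by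
    have h4 : a * (f + k * b) = (a * f - b * e) + b * (e + k * a) := by ring
    rw [← abs_mul, h4]
    refine (abs_add_le _ _).trans ?_
    rw [h, abs_mul]
  have h5 : |b| * |e + k * a| ≤ |a| * |a| := mul_le_mul hba h1 (abs_nonneg _) (abs_nonneg _)
  have h6 : |a| * |e + k * a| ≤ |a| * |a| := mul_le_mul_of_nonneg_left h1 (abs_nonneg _)
  calc (|a| + |b|) * (|e + k * a| + |f + k * b|)
      ≤ (|a| + |a|) * (|e + k * a| + |f + k * b|) := by gcongr
    _ ≤ 6 * l := by nlinarith

theorem exists_int_mul_le {a b e f l : ℝ} (hl : 0 < l) (h : |a * f - b * e| = l)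
    (ha : |a| ^ 2 ≤ l) (hb : |b| ^ 2 ≤ l) :
    ∃ k : ℤ, (|a| + |b|) * (|e + k * a| + |f + k * b|) ≤ 6 * l := by
  rcases le_total |b| |a| with hba | hab
  · exact exists_int_mul_le_of_abs_le hl h ha hba
  · rw [abs_sub_comm] at h
    obtain ⟨k, hk⟩ := exists_int_mul_le_of_abs_le hl h hb hab
    refine ⟨k, ?_⟩
    rwa [add_comm |a|, add_comm |e + k * a|]

theorem exists_coprime_approx (z : ℝ) {l : ℝ} (hl : 0 < l) :
    ∃ p q : ℤ, IsCoprime p q ∧ |(p : ℝ) - z * q| ≤ √l ∧ l * |(q : ℝ)| ≤ √l := by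
  have hs : 0 < √l := Real.sqrt_pos.mpr hl
  have hss : √l * √l = l := Real.mul_self_sqrt hl.le
  rcases le_or_gt l 1 with hl1 | hl1
  · have hs1 : √l ≤ 1 := Real.sqrt_le_one.mpr hl1
    have hn : 0 < ⌊1 / √l⌋₊ := Nat.floor_pos.mpr (by rwa [one_le_div hs])
    obtain ⟨x, hx, hxn⟩ := Real.exists_rat_abs_sub_le_and_den_le z hn
    refine ⟨x.num, x.den, Rat.isCoprime_num_den x, ?_, ?_⟩
    · have hd : (0 : ℝ) < x.den := by exact_mod_cast x.pos
      have h1 : (x.num : ℝ) - z * ((x.den : ℤ) : ℝ) = -((z - x) * x.den) := by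
        rw [Rat.cast_def x]
        push_cast
        field_simp
        ring
      rw [h1, abs_neg, abs_mul, abs_of_pos hd]
      have h2 := Nat.lt_floor_add_one (1 / √l)
      have h3 : |z - x| * x.den ≤ 1 / (⌊1 / √l⌋₊ + 1) := by
        calc |z - x| * x.den ≤ 1 / ((⌊1 / √l⌋₊ + 1) * x.den) * x.den := by gcongr
          _ = _ := by field_simp
      refine h3.trans ?_
      rw [div_le_iff₀ (by positivity)]
      rw [div_lt_iff₀ hs] at h2
      linarith
    · have h1 : (x.den : ℝ) ≤ 1 / √l :=
        (Nat.cast_le.mpr hxn).trans (Nat.floor_le (by positivity))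
      rw [le_div_iff₀ hs] at h1
      rw [Int.cast_natCast, abs_of_nonneg (by positivity)]
      nlinarith
  · refine ⟨1, 0, isCoprime_one_left, ?_, ?_⟩
    · simpa using hl1.le
    · simp

theorem exists_reduced_basis (z : ℝ) {l : ℝ} (hl : 0 < l) :
    ∃ p q r s : ℤ, p * s - q * r = 1 ∧ |(p : ℝ) - z * q| + l * |(q : ℝ)| ≤ 2 * √l ∧
      (|(p : ℝ) - z * q| + l * |(q : ℝ)|) * (|(r : ℝ) - z * s| + l * |(s : ℝ)|) ≤ 6 * l := by
  obtain ⟨p, q, ⟨s, r, hc⟩, h1, h2⟩ := exists_coprime_approx z hl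
  have habs : ∀ x : ℝ, |l * x| = l * |x| := fun x ↦ by rw [abs_mul, abs_of_pos hl]
  have hc' : (s * p + r * q : ℝ) = 1 := by exact_mod_cast hc
  obtain ⟨k, hk⟩ := exists_int_mul_le (a := p - z * q) (b := l * q) (e := -r - z * s)
    (f := l * s) hl
    (by
      rw [show (p - z * q) * (l * s) - l * q * (-r - z * s) = l * (s * p + r * q) by ring, hc',
        mul_one, abs_of_pos hl])
    (by
      calc _ ≤ √l ^ 2 := by gcongr
        _ = l := Real.sq_sqrt hl.le)
    (by
      rw [habs]
      calc _ ≤ √l ^ 2 := by gcongr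
        _ = l := Real.sq_sqrt hl.le)
  refine ⟨p, q, -r + k * p, s + k * q, ?_, by linarith, ?_⟩
  · linear_combination hc
  · rw [habs, show (-r - z * s + k * (p - z * q) : ℝ) =
      ((-r + k * p : ℤ) : ℝ) - z * ((s + k * q : ℤ) : ℝ) by push_cast; ring,
      show (l * s + k * (l * q) : ℝ) = l * ((s + k * q : ℤ) : ℝ) by push_cast; ring, habs] at hk
    exact hk

/-- An integral form without linear factors of multiplicity above `d / 2` cannot be small at a
point which is at distance at least `l` from its roots. -/
theorem sqrt_pow_le_norm_eval_dehom {F : MvPolynomial (Fin 2) ℤ} {d : ℕ} (hF0 : F ≠ 0)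
    (hF : F.IsHomogeneous d) (hm : MultiplicityLEHalf F d) {z l : ℝ} (hl : 0 < l)
    (hz : ∀ α ∈ (dehom F).roots, l ≤ ‖(z : ℂ) - α‖) :
    √l ^ d ≤ 12 ^ d * ‖(dehom F).eval (z : ℂ)‖ := by
  obtain ⟨p, q, r, s, hdet, hA, hAB⟩ := exists_reduced_basis z hl
  have hs : 0 < √l := Real.sqrt_pos.mpr hl
  have hss : √l ^ 2 = l := Real.sq_sqrt hl.le
  set A := |(p : ℝ) - z * q| + l * |(q : ℝ)| with hAdef
  set B := |(r : ℝ) - z * s| + l * |(s : ℝ)| with hBdef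
  have hA0 : 0 ≤ A := by positivity
  have hB0 : 0 ≤ B := by positivity
  set g := restrictLine F p q r s with hg
  set i := g.natDegree with hi
  have hid : i ≤ d := natDegree_restrictLine_le hF p q r s
  have hdi : d ≤ 2 * i := le_two_mul_natDegree_restrictLine hF hm hdet
  have hg0 : g ≠ 0 := restrictLine_ne_zero hF hF0 hdet
  have hlow : 1 ≤ ‖(g.map (Int.castRingHom ℂ)).coeff i‖ := by
    rw [Polynomial.coeff_map, hi, Polynomial.coeff_natDegree, eq_intCast,
      ← Complex.ofReal_intCast, Complex.norm_real, Real.norm_eq_abs]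
    exact_mod_cast Int.one_le_abs (Polynomial.leadingCoeff_ne_zero.mpr hg0)
  have hup := coeffLE_restrictLine hF hl hz hAdef.ge hBdef.ge i
  rw [Polynomial.coeff_C_mul, coeff_linear_pow _ _ _ _ hid] at hup
  set K := ‖(dehom F).eval (z : ℂ)‖ with hK
  have hpow : A ^ i * B ^ (d - i) ≤ 6 ^ d * √l ^ d := by
    have e1 : A ^ i = A ^ (2 * i - d) * A ^ (d - i) := by
      rw [← pow_add]
      congr 1
      omega
    have e2 : √l ^ d = √l ^ (2 * i - d) * l ^ (d - i) := by
      have : l ^ (d - i) = √l ^ (2 * (d - i)) := by rw [pow_mul, hss]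
      rw [this, ← pow_add]
      congr 1
      omega
    calc A ^ i * B ^ (d - i) = A ^ (2 * i - d) * (A * B) ^ (d - i) := by
          rw [e1, mul_pow]
          ring
      _ ≤ (2 * √l) ^ (2 * i - d) * (6 * l) ^ (d - i) := by gcongr
      _ ≤ (6 * √l) ^ (2 * i - d) * (6 * l) ^ (d - i) := by
          gcongr
          norm_num
      _ = 6 ^ i * √l ^ d := by
          have : 6 ^ i = (6 : ℝ) ^ (2 * i - d) * 6 ^ (d - i) := by
            rw [← pow_add]
            congr 1
            omega
          rw [e2, mul_pow, mul_pow, this]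
          ring
      _ ≤ 6 ^ d * √l ^ d := by
          gcongr
          norm_num
  have hchoose : (d.choose i : ℝ) ≤ 2 ^ d := by exact_mod_cast Nat.choose_le_two_pow d i
  have hfin : 1 ≤ K / l ^ d * (6 ^ d * √l ^ d * 2 ^ d) := by
    refine (hlow.trans hup).trans ?_
    gcongr
  have hld : l ^ d = √l ^ d * √l ^ d := by rw [← mul_pow, ← sq, hss]
  have h12 : (12 : ℝ) ^ d = 6 ^ d * 2 ^ d := by
    rw [← mul_pow]
    norm_num
  have hsd : 0 < √l ^ d := by positivity
  have heq : K / l ^ d * (6 ^ d * √l ^ d * 2 ^ d) = 12 ^ d * K / √l ^ d := by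
    rw [hld, h12]
    field_simp
  rwa [heq, one_le_div hsd] at hfin

theorem abs_eval_eq {F : MvPolynomial (Fin 2) ℤ} {d : ℕ} (hF : F.IsHomogeneous d)
    {x : Fin 2 → ℤ} (hx : x 1 ≠ 0) :
    |((MvPolynomial.eval x F : ℤ) : ℝ)| =
      ‖(dehom F).eval (((x 0 : ℝ) / x 1 : ℝ) : ℂ)‖ * |(x 1 : ℝ)| ^ d := by
  have hx' : (x 1 : ℂ) ≠ 0 := by exact_mod_cast hx
  have h1 : (dehom F).homogenize d = MvPolynomial.map (Int.castRingHom ℂ) F :=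
    Polynomial.homogenize_eq_of_isHomogeneous (hF.map _) rfl
  have h2 := Polynomial.eval_homogenize (natDegree_dehom_le hF) (fun i ↦ (x i : ℂ)) hx'
  have h3 : MvPolynomial.eval (fun i ↦ (x i : ℂ)) (MvPolynomial.map (Int.castRingHom ℂ) F) =
      ((MvPolynomial.eval x F : ℤ) : ℂ) := by
    rw [MvPolynomial.eval_map]
    exact (MvPolynomial.eval₂_comp_left (Int.castRingHom ℂ) (RingHom.id ℤ) x F).symm
  rw [h1, h3] at h2
  have h4 := congrArg norm h2
  rw [norm_mul, norm_pow, Complex.norm_intCast, Complex.norm_intCast] at h4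
  rw [h4]
  push_cast
  rfl

theorem card_le_of_roots_far {F : MvPolynomial (Fin 2) ℤ} {d : ℕ} (hd : d ≠ 0) (hF0 : F ≠ 0)
    (hF : F.IsHomogeneous d) (hm : MultiplicityLEHalf F d) (Λ : Submodule ℤ (Fin 2 → ℤ))
    (hΛ : Λ.toAddSubgroup.index ≠ 0) {P l : ℝ} (hP : 1 ≤ P) (hl : 0 < l)
    (S : Finset (Fin 2 → ℤ))
    (hS : ∀ x ∈ S, x ∈ Λ ∧ Int.gcd (x 0) (x 1) = 1 ∧ x 1 ≠ 0 ∧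
      |((MvPolynomial.eval x F : ℤ) : ℝ)| ≤ P ∧
      ∀ α ∈ (dehom F).roots, l ≤ ‖(((x 0 : ℝ) / x 1 : ℝ) : ℂ) - α‖)
    (hdiam : ∀ x ∈ S, ∀ y ∈ S, |(x 0 : ℝ) / x 1 - (y 0 : ℝ) / y 1| ≤ 4 * l) :
    (S.card : ℝ) ≤ 2304 * (P ^ ((2 : ℝ) / d) / Λ.toAddSubgroup.index + 1) := by
  have hs : 0 < √l := Real.sqrt_pos.mpr hl
  have hss : √l ^ 2 = l := Real.sq_sqrt hl.le
  have hP0 : 0 < P := by linarith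
  have hQ : 0 ≤ P ^ ((2 : ℝ) / d) / Λ.toAddSubgroup.index := by positivity
  rcases S.eq_empty_or_nonempty with rfl | ⟨x₀, hx₀⟩
  · simp only [Finset.card_empty, Nat.cast_zero]
    linarith
  set T := P ^ ((1 : ℝ) / d) with hT
  have hT0 : 0 < T := by positivity
  have hd' : (d : ℝ) ≠ 0 := by exact_mod_cast hd
  have hTd : T ^ d = P := by
    rw [hT, ← Real.rpow_natCast, ← Real.rpow_mul hP0.le, one_div, inv_mul_cancel₀ hd',
      Real.rpow_one]
  have hT2 : T ^ 2 = P ^ ((2 : ℝ) / d) := by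
    rw [hT, ← Real.rpow_natCast, ← Real.rpow_mul hP0.le]
    congr 1
    push_cast
    ring
  have hcount := card_le_of_slope_near Λ hΛ S ((x₀ 0 : ℝ) / x₀ 1) (4 * l) (12 * T / √l)
    (by positivity) (by positivity) (fun x hx ↦ by
      obtain ⟨h1, h2, h3, h4, h5⟩ := hS x hx
      refine ⟨h1, h2, h3, ?_, hdiam x hx x₀ hx₀⟩
      have h6 := sqrt_pow_le_norm_eval_dehom hF0 hF hm hl h5
      rw [abs_eval_eq hF h3] at h4
      rw [le_div_iff₀ hs]
      refine le_of_pow_le_pow_left₀ hd (by positivity) ?_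
      rw [mul_pow, mul_pow, hTd]
      calc |(x 1 : ℝ)| ^ d * √l ^ d
          ≤ |(x 1 : ℝ)| ^ d *
            (12 ^ d * ‖(dehom F).eval (((x 0 : ℝ) / x 1 : ℝ) : ℂ)‖) := by gcongr
        _ = 12 ^ d * (‖(dehom F).eval (((x 0 : ℝ) / x 1 : ℝ) : ℂ)‖ * |(x 1 : ℝ)| ^ d) := by ring
        _ ≤ 12 ^ d * P := by gcongr)
  have heq : 2 * (4 * l) * (12 * T / √l) ^ 2 = 1152 * P ^ ((2 : ℝ) / d) := by
    rw [div_pow, hss, ← hT2]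
    field_simp
    ring
  rw [heq, mul_div_assoc] at hcount
  linarith

theorem card_Icc_log_le {B : ℝ} (hB : 2 ≤ B) :
    ((Finset.Icc (Int.log 2 (1 / B ^ 2)) (Int.log 2 B)).card : ℝ) ≤ 9 * Real.log B := by
  have hB0 : 0 < B := by linarith
  have hlog2 := Real.log_two_gt_d9
  have hlogB : Real.log 2 ≤ Real.log B := Real.log_le_log (by norm_num) hB
  have h1 : (Int.log 2 B : ℝ) * Real.log 2 ≤ Real.log B := by
    have := Int.zpow_log_le_self (b := 2) (by norm_num) hB0
    rw [← Real.log_zpow]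
    exact Real.log_le_log (by positivity) (by exact_mod_cast this)
  have h2 : -(2 * Real.log B) ≤ ((Int.log 2 (1 / B ^ 2) : ℝ) + 1) * Real.log 2 := by
    have := Int.lt_zpow_succ_log_self (b := 2) (by norm_num) (1 / B ^ 2)
    have h3 := Real.log_le_log (by positivity) this.le
    have h4 : Real.log (1 / B ^ 2) = -(2 * Real.log B) := by
      rw [one_div, Real.log_inv, Real.log_pow]
      push_cast
      rfl
    rw [Nat.cast_ofNat, Real.log_zpow, h4] at h3
    push_cast at h3
    exact h3
  have hle : Int.log 2 (1 / B ^ 2) ≤ Int.log 2 B := by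
    refine Int.log_mono_right (by positivity) ?_
    rw [div_le_iff₀ (by positivity)]
    nlinarith
  have hcard : ((Finset.Icc (Int.log 2 (1 / B ^ 2)) (Int.log 2 B)).card : ℝ) =
      Int.log 2 B + 1 - Int.log 2 (1 / B ^ 2) := by
    have : ((Finset.Icc (Int.log 2 (1 / B ^ 2)) (Int.log 2 B)).card : ℤ) =
        Int.log 2 B + 1 - Int.log 2 (1 / B ^ 2) := by
      rw [Int.card_Icc, Int.toNat_of_nonneg (by linarith)]
    exact_mod_cast this
  rw [hcard]
  have h5 : ((Int.log 2 B : ℝ) + 1 - Int.log 2 (1 / B ^ 2)) * Real.log 2 ≤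
      (9 * Real.log B) * Real.log 2 := by
    nlinarith
  exact le_of_mul_le_mul_right h5 (by linarith)

theorem card_le_of_bounded {F : MvPolynomial (Fin 2) ℤ} {d : ℕ} (hd : d ≠ 0) (hF0 : F ≠ 0)
    (hF : F.IsHomogeneous d) (hm : MultiplicityLEHalf F d) (Λ : Submodule ℤ (Fin 2 → ℤ))
    (hΛ : Λ.toAddSubgroup.index ≠ 0) {B P : ℝ} (hB : 2 ≤ B) (hP : 1 ≤ P)
    (S : Finset (Fin 2 → ℤ))
    (hS : ∀ x ∈ S, x ∈ Λ ∧ Int.gcd (x 0) (x 1) = 1 ∧ |(x 0 : ℝ)| ≤ B ∧ |(x 1 : ℝ)| ≤ B ∧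
      |((MvPolynomial.eval x F : ℤ) : ℝ)| ≤ P) :
    (S.card : ℝ) ≤
      30000 * (d + 1) * (P ^ ((2 : ℝ) / d) / Λ.toAddSubgroup.index + 1) * Real.log B := by
  classical
  have hB0 : 0 < B := by linarith
  set E := P ^ ((2 : ℝ) / d) / Λ.toAddSubgroup.index + 1 with hE
  have hE1 : 1 ≤ E := by
    have : 0 ≤ P ^ ((2 : ℝ) / d) / Λ.toAddSubgroup.index := by positivity
    linarith
  set R := (dehom F).roots.toFinset with hR
  have hRcard : R.card ≤ d :=
    ((Multiset.toFinset_card_le _).trans (Polynomial.card_roots' _)).trans (natDegree_dehom_le hF)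
  set K := Finset.Icc (Int.log 2 (1 / B ^ 2)) (Int.log 2 B) with hK
  set w : (Fin 2 → ℤ) → ℝ := fun x ↦ (x 0 : ℝ) / x 1 with hw
  have hwB : ∀ x ∈ S, |w x| ≤ B := by
    intro x hx
    simp only [hw, abs_div]
    by_cases h0 : x 1 = 0
    · simp [h0, hB0.le]
    · have h1 : (1 : ℝ) ≤ |(x 1 : ℝ)| := by exact_mod_cast Int.one_le_abs h0
      rw [div_le_iff₀ (by linarith)]
      nlinarith [(hS x hx).2.2.1]
  set axis := S.filter fun x ↦ x 1 = 0 with haxis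
  set far := S.filter fun x ↦ x 1 ≠ 0 ∧ ∀ β ∈ R, B ≤ ‖(w x : ℂ) - β‖ with hfar
  set near : ℂ → Finset (Fin 2 → ℤ) := fun α ↦
    S.filter fun x ↦ x 1 ≠ 0 ∧ ‖(w x : ℂ) - α‖ ≤ 1 / B ^ 2 with hnear
  set mid : ℂ × ℤ → Finset (Fin 2 → ℤ) := fun a ↦
    S.filter fun x ↦ x 1 ≠ 0 ∧ ‖(w x : ℂ) - a.1‖ ≤ 2 * 2 ^ a.2 ∧
      ∀ β ∈ R, 2 ^ a.2 ≤ ‖(w x : ℂ) - β‖ with hmid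
  have hcover : S ⊆ (axis ∪ far) ∪ (R.biUnion near ∪ (R ×ˢ K).biUnion mid) := by
    intro x hx
    simp only [Finset.mem_union, Finset.mem_biUnion]
    by_cases h0 : x 1 = 0
    · exact Or.inl (Or.inl (Finset.mem_filter.mpr ⟨hx, h0⟩))
    by_cases hf : ∀ β ∈ R, B ≤ ‖(w x : ℂ) - β‖
    · exact Or.inl (Or.inr (Finset.mem_filter.mpr ⟨hx, h0, hf⟩))
    push Not at hf
    obtain ⟨β₀, hβ₀, hβB⟩ := hf
    obtain ⟨α, hα, hmin⟩ := R.exists_min_image (fun β ↦ ‖(w x : ℂ) - β‖) ⟨β₀, hβ₀⟩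
    right
    rcases le_or_gt ‖(w x : ℂ) - α‖ (1 / B ^ 2) with hle | hgt
    · exact Or.inl ⟨α, hα, Finset.mem_filter.mpr ⟨hx, h0, hle⟩⟩
    have hpos : 0 < ‖(w x : ℂ) - α‖ := lt_trans (by positivity) hgt
    have hk1 := Int.zpow_log_le_self (b := 2) (by norm_num) hpos
    have hk2 := Int.lt_zpow_succ_log_self (b := 2) (by norm_num) ‖(w x : ℂ) - α‖
    rw [Nat.cast_ofNat] at hk1 hk2
    refine Or.inr ⟨(α, Int.log 2 ‖(w x : ℂ) - α‖), ?_, Finset.mem_filter.mpr ⟨hx, h0, ?_, ?_⟩⟩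
    · refine Finset.mem_product.mpr ⟨hα, Finset.mem_Icc.mpr ⟨?_, ?_⟩⟩
      · exact Int.log_mono_right (by positivity) hgt.le
      · exact Int.log_mono_right hpos ((hmin β₀ hβ₀).trans hβB.le)
    · rw [zpow_add_one₀ (by norm_num)] at hk2
      linarith
    · exact fun β hβ ↦ hk1.trans (hmin β hβ)
  have haxis_card : axis.card ≤ 2 := by
    have : axis ⊆ {![1, 0], ![-1, 0]} := by
      intro x hx
      obtain ⟨hxS, hx1⟩ := Finset.mem_filter.mp hx
      have hg := (hS x hxS).2.1
      rw [hx1, Int.gcd_zero_right] at hg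
      rcases Int.natAbs_eq_iff.mp hg with h | h
      · have : x = ![1, 0] := by
          ext i
          fin_cases i <;> simp [hx1, h]
        simp [this]
      · have : x = ![-1, 0] := by
          ext i
          fin_cases i <;> simp [hx1, h]
        simp [this]
    exact (Finset.card_le_card this).trans Finset.card_le_two
  have hfar_card : (far.card : ℝ) ≤ 2304 * E := by
    refine card_le_of_roots_far hd hF0 hF hm Λ hΛ hP hB0 far ?_ ?_
    · intro x hx
      obtain ⟨hxS, hx1, hx2⟩ := Finset.mem_filter.mp hx
      obtain ⟨h1, h2, -, -, h3⟩ := hS x hxS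
      exact ⟨h1, h2, hx1, h3, fun α hα ↦ hx2 α (Multiset.mem_toFinset.mpr hα)⟩
    · intro x hx y hy
      have h1 := hwB x (Finset.mem_filter.mp hx).1
      have h2 := hwB y (Finset.mem_filter.mp hy).1
      exact (abs_sub _ _).trans (by linarith)
  have hnear_card : ∀ α ∈ R, (near α).card ≤ 6 := by
    intro α _
    have h := card_le_of_slope_near Λ hΛ (near α) α.re (1 / B ^ 2) B hB0 (by positivity)
      (fun x hx ↦ by
        obtain ⟨hxS, hx1, hx2⟩ := Finset.mem_filter.mp hx
        obtain ⟨h1, h2, -, h3, -⟩ := hS x hxS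
        refine ⟨h1, h2, hx1, h3, ?_⟩
        have := Complex.abs_re_le_norm ((w x : ℂ) - α)
        rw [Complex.sub_re, Complex.ofReal_re] at this
        exact this.trans hx2)
    have h1 : 2 * (1 / B ^ 2) * B ^ 2 = 2 := by field_simp
    have h2 : (2 : ℝ) / Λ.toAddSubgroup.index ≤ 2 :=
      div_le_self (by norm_num) (by exact_mod_cast Nat.one_le_iff_ne_zero.mpr hΛ)
    rw [h1] at h
    have h3 : ((near α).card : ℝ) ≤ 6 := by linarith
    exact_mod_cast h3
  have hmid_card : ∀ a ∈ R ×ˢ K, ((mid a).card : ℝ) ≤ 2304 * E := by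
    intro a _
    refine card_le_of_roots_far hd hF0 hF hm Λ hΛ hP (l := 2 ^ a.2) (by positivity) _ ?_ ?_
    · intro x hx
      obtain ⟨hxS, hx1, -, hx2⟩ := Finset.mem_filter.mp hx
      obtain ⟨h1, h2, -, -, h3⟩ := hS x hxS
      exact ⟨h1, h2, hx1, h3, fun α hα ↦ hx2 α (Multiset.mem_toFinset.mpr hα)⟩
    · intro x hx y hy
      have h1 := (Finset.mem_filter.mp hx).2.2.1
      have h2 := (Finset.mem_filter.mp hy).2.2.1
      have h3 : |w x - w y| = ‖((w x : ℂ) - a.1) - ((w y : ℂ) - a.1)‖ := by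
        rw [sub_sub_sub_cancel_right, ← Complex.ofReal_sub, Complex.norm_real, Real.norm_eq_abs]
      change |w x - w y| ≤ _
      rw [h3]
      exact (norm_sub_le _ _).trans (by linarith)
  have hnear_sum : ((R.biUnion near).card : ℝ) ≤ d * 6 := by
    have := (Finset.card_biUnion_le_card_mul R near 6 hnear_card).trans
      (Nat.mul_le_mul_right 6 hRcard)
    exact_mod_cast this
  have hmid_sum : (((R ×ˢ K).biUnion mid).card : ℝ) ≤ d * (9 * Real.log B) * (2304 * E) := by
    calc (((R ×ˢ K).biUnion mid).card : ℝ) ≤ ((∑ a ∈ R ×ˢ K, (mid a).card : ℕ) : ℝ) := by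
          exact_mod_cast Finset.card_biUnion_le
      _ = ∑ a ∈ R ×ˢ K, ((mid a).card : ℝ) := by push_cast; rfl
      _ ≤ ∑ _a ∈ R ×ˢ K, 2304 * E := Finset.sum_le_sum hmid_card
      _ = R.card * K.card * (2304 * E) := by simp
      _ ≤ d * (9 * Real.log B) * (2304 * E) := by
          have h1 : (R.card : ℝ) ≤ d := by exact_mod_cast hRcard
          have h2 := card_Icc_log_le hB
          gcongr
  have htotal : (S.card : ℝ) ≤ 2 + 2304 * E + (d * 6 + d * (9 * Real.log B) * (2304 * E)) := by
    have h1 : S.card ≤ (axis.card + far.card) +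
        ((R.biUnion near).card + ((R ×ˢ K).biUnion mid).card) :=
      (Finset.card_le_card hcover).trans ((Finset.card_union_le _ _).trans
        (add_le_add (Finset.card_union_le _ _) (Finset.card_union_le _ _)))
    have h2 : (S.card : ℝ) ≤ (axis.card + far.card) +
        ((R.biUnion near).card + ((R ×ˢ K).biUnion mid).card) := by exact_mod_cast h1
    have h3 : (axis.card : ℝ) ≤ 2 := by exact_mod_cast haxis_card
    linarith
  have hlog : 1 ≤ 2 * Real.log B := by
    have := Real.log_two_gt_d9
    have := Real.log_le_log (by norm_num) hB
    linarith
  have hEL : 1 ≤ 2 * (E * Real.log B) := by nlinarith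
  have hEL' : E ≤ 2 * (E * Real.log B) := by nlinarith
  have hdEL : (d : ℝ) ≤ 2 * (d * (E * Real.log B)) := by
    have : (0 : ℝ) ≤ d := Nat.cast_nonneg d
    nlinarith
  refine htotal.trans ?_
  have h0 : (0 : ℝ) ≤ d * (E * Real.log B) :=
    mul_nonneg (Nat.cast_nonneg d) (mul_nonneg (by linarith) (by linarith))
  nlinarith

theorem statement9 (d : ℕ) (hd : 2 ≤ d) :
    ∃ c : ℝ, 0 < c ∧
      ∀ F : MvPolynomial (Fin 2) ℤ, F ≠ 0 → F.IsHomogeneous d → MultiplicityLEHalf F d →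
        (∀ Λ : Submodule ℤ (Fin 2 → ℤ), Λ.toAddSubgroup.index ≠ 0 →
          ∀ B P : ℝ, 2 ≤ B → 1 ≤ P →
            (Set.ncard {x : Fin 2 → ℤ | x ∈ Λ ∧ Int.gcd (x 0) (x 1) = 1 ∧
                ((|x 0| : ℤ) : ℝ) ≤ B ∧ ((|x 1| : ℤ) : ℝ) ≤ B ∧
                1 ≤ |MvPolynomial.eval x F| ∧
                ((|MvPolynomial.eval x F| : ℤ) : ℝ) ≤ P} : ℝ)
              ≤ c * (P ^ ((2 : ℝ) / d) / (Λ.toAddSubgroup.index : ℝ) + 1) * Real.log B) ∧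
        (∀ B P : ℝ, 2 ≤ B → 1 ≤ P →
          (Set.ncard {x : Fin 2 → ℤ | Int.gcd (x 0) (x 1) = 1 ∧
              ((|x 0| : ℤ) : ℝ) ≤ B ∧ ((|x 1| : ℤ) : ℝ) ≤ B ∧
              1 ≤ |MvPolynomial.eval x F| ∧
              ((|MvPolynomial.eval x F| : ℤ) : ℝ) ≤ P} : ℝ)
            ≤ c * P ^ ((2 : ℝ) / d) * Real.log B) := by
  refine ⟨60000 * (d + 1), by positivity, fun F hF0 hF hm ↦ ?_⟩
  have key : ∀ Λ : Submodule ℤ (Fin 2 → ℤ), Λ.toAddSubgroup.index ≠ 0 →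
      ∀ B P : ℝ, 2 ≤ B → 1 ≤ P →
        (Set.ncard {x : Fin 2 → ℤ | x ∈ Λ ∧ Int.gcd (x 0) (x 1) = 1 ∧
            ((|x 0| : ℤ) : ℝ) ≤ B ∧ ((|x 1| : ℤ) : ℝ) ≤ B ∧
            1 ≤ |MvPolynomial.eval x F| ∧
            ((|MvPolynomial.eval x F| : ℤ) : ℝ) ≤ P} : ℝ)
          ≤ 30000 * (d + 1) * (P ^ ((2 : ℝ) / d) / (Λ.toAddSubgroup.index : ℝ) + 1) *
            Real.log B := by
    intro Λ hΛ B P hB hP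
    set T := {x : Fin 2 → ℤ | x ∈ Λ ∧ Int.gcd (x 0) (x 1) = 1 ∧
            ((|x 0| : ℤ) : ℝ) ≤ B ∧ ((|x 1| : ℤ) : ℝ) ≤ B ∧
            1 ≤ |MvPolynomial.eval x F| ∧
            ((|MvPolynomial.eval x F| : ℤ) : ℝ) ≤ P} with hT
    have hfin : T.Finite := by
      refine (Set.finite_Icc (fun _ ↦ -⌊B⌋ : Fin 2 → ℤ) (fun _ ↦ ⌊B⌋)).subset ?_
      rintro x ⟨-, -, h0, h1, -⟩
      have h0' := abs_le.mp (Int.le_floor.mpr h0)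
      have h1' := abs_le.mp (Int.le_floor.mpr h1)
      refine ⟨fun i ↦ ?_, fun i ↦ ?_⟩ <;> fin_cases i
      exacts [h0'.1, h1'.1, h0'.2, h1'.2]
    rw [Set.ncard_eq_toFinset_card T hfin]
    refine card_le_of_bounded (by omega) hF0 hF hm Λ hΛ hB hP _ fun x hx ↦ ?_
    obtain ⟨h1, h2, h3, h4, -, h5⟩ := hfin.mem_toFinset.mp hx
    rw [Int.cast_abs] at h3 h4 h5
    exact ⟨h1, h2, h3, h4, h5⟩
  have hlog : ∀ B : ℝ, 2 ≤ B → 0 ≤ Real.log B := fun B hB ↦ Real.log_nonneg (by linarith)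
  refine ⟨fun Λ hΛ B P hB hP ↦ (key Λ hΛ B P hB hP).trans ?_, fun B P hB hP ↦ ?_⟩
  · have := hlog B hB
    gcongr
    norm_num
  · have h := key ⊤ (by simp) B P hB hP
    have htop : (⊤ : Submodule ℤ (Fin 2 → ℤ)).toAddSubgroup.index = 1 := by simp
    simp only [Submodule.mem_top, true_and, htop, Nat.cast_one, div_one] at h
    refine h.trans ?_
    have h1 : 1 ≤ P ^ ((2 : ℝ) / d) := Real.one_le_rpow hP (by positivity)
    have h2 := hlog B hB
    calc 30000 * ((d : ℝ) + 1) * (P ^ ((2 : ℝ) / d) + 1) * Real.log B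
        ≤ 30000 * ((d : ℝ) + 1) * (P ^ ((2 : ℝ) / d) + P ^ ((2 : ℝ) / d)) * Real.log B := by
          gcongr
      _ = 60000 * (d + 1) * P ^ ((2 : ℝ) / d) * Real.log B := by ring
end

section
/- Let k ≥ 1 be an integer, let I ⊆ ℝ be an open interval, and let h : I → ℝ be k times continuously differentiable with |h^{(k)}(x)| ≥ C > 0 for all x ∈ I. Then for every δ > 0 the Lebesgue measure of the set {x ∈ I : |h(x)| ≤ δ} is at most 2e·((k+1)!)^{1/k}·(δ/C)^{1/k}. -/
/-- Iterated Rolle: a function with `k + 1` zeros has a `k`-th derivative that vanishes somewhere. -/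
theorem exists_iteratedDerivWithin_eq_zero_of_zeros {a b : ℝ} (k : ℕ) {f : ℝ → ℝ}
    (hf : ContDiffOn ℝ k f (Set.Ioo a b)) {x : ℕ → ℝ}
    (hx : ∀ i ≤ k, x i ∈ Set.Ioo a b) (hlt : ∀ i < k, x i < x (i + 1))
    (hzero : ∀ i ≤ k, f (x i) = 0) :
    ∃ ξ ∈ Set.Ioo a b, iteratedDerivWithin k f (Set.Ioo a b) ξ = 0 := by
  induction k generalizing f x with
  | zero => exact ⟨x 0, hx 0 le_rfl, by simpa using hzero 0 le_rfl⟩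
  | succ k ih =>
    have rolle : ∀ i, ∃ y, i ≤ k → x i < y ∧ y < x (i + 1) ∧ deriv f y = 0 := by
      intro i
      by_cases hi : i ≤ k
      · obtain ⟨y, hy, hy'⟩ := exists_deriv_eq_zero (hlt i (by lia))
          (hf.continuousOn.mono (Set.Icc_subset_Ioo (hx i (by lia)).1 (hx (i + 1) (by lia)).2))
          ((hzero i (by lia)).trans (hzero (i + 1) (by lia)).symm)
        exact ⟨y, fun _ => ⟨hy.1, hy.2, hy'⟩⟩
      · exact ⟨0, fun h => absurd h hi⟩
    choose y hy using rolle
    have hymem : ∀ i ≤ k, y i ∈ Set.Ioo a b := fun i hi =>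
      ⟨(hx i (by lia)).1.trans (hy i hi).1, (hy i hi).2.1.trans (hx (i + 1) (by lia)).2⟩
    rw [iteratedDerivWithin_succ']
    refine ih (hf.derivWithin isOpen_Ioo.uniqueDiffOn (by norm_cast)) hymem
      (fun i hi => (hy i hi.le).2.1.trans (hy (i + 1) hi).1) fun i hi => ?_
    rw [derivWithin_of_isOpen isOpen_Ioo (hymem i hi)]
    exact (hy i hi).2.2

theorem Polynomial.iteratedDeriv_eval (p : Polynomial ℝ) (k : ℕ) :
    iteratedDeriv k (fun x => p.eval x) = fun x => (Polynomial.derivative^[k] p).eval x := by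
  induction k generalizing p with
  | zero => simp
  | succ k ih =>
    rw [iteratedDeriv_succ', Function.iterate_succ_apply, ← ih]
    congr 1
    ext x
    exact p.deriv

open Finset in
/-- Mean value theorem for divided differences. -/
theorem exists_iteratedDerivWithin_eq_factorial_mul_sum {a b : ℝ} (k : ℕ) {f : ℝ → ℝ}
    (hf : ContDiffOn ℝ k f (Set.Ioo a b)) {x : ℕ → ℝ}
    (hx : ∀ i ≤ k, x i ∈ Set.Ioo a b) (hlt : ∀ i < k, x i < x (i + 1))
    (hinj : Set.InjOn x (range (k + 1))) :
    ∃ ξ ∈ Set.Ioo a b, iteratedDerivWithin k f (Set.Ioo a b) ξ =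
      k.factorial * ∑ i ∈ range (k + 1), f (x i) / ∏ j ∈ (range (k + 1)).erase i, (x i - x j) := by
  set p := Lagrange.interpolate (range (k + 1)) x (fun i => f (x i))
  have hpdeg : p.degree < #(range (k + 1)) := Lagrange.degree_interpolate_lt _ hinj
  have hpeval : ∀ i ∈ range (k + 1), p.eval (x i) = f (x i) := fun i hi =>
    Lagrange.eval_interpolate_at_node _ hinj hi
  have hpcont : ContDiff ℝ k (fun t => p.eval t) := by
    simpa using p.contDiff_aeval (𝕜 := ℝ) k
  obtain ⟨ξ, hξ, h0⟩ := exists_iteratedDerivWithin_eq_zero_of_zeros k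
    (f := f - fun t => p.eval t) (hf.sub hpcont.contDiffOn) hx hlt fun i hi => by
      simp [hpeval i (by simp; lia)]
  refine ⟨ξ, hξ, ?_⟩
  rw [iteratedDerivWithin_sub hξ isOpen_Ioo.uniqueDiffOn (hf ξ hξ)
    hpcont.contDiffWithinAt, sub_eq_zero] at h0
  rw [h0, iteratedDerivWithin_of_isOpen isOpen_Ioo hξ, Polynomial.iteratedDeriv_eval]
  dsimp only
  rw [Lagrange.eval_iterate_derivative_eq_sum hinj hpdeg (by simp)]
  congr 1
  refine sum_congr rfl fun i hi => ?_
  simp [hpeval i hi]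

theorem mul_sub_le_sub_of_forall_add_le {d : ℝ} {k : ℕ} {x : ℕ → ℝ}
    (hgap : ∀ i < k, x i + d ≤ x (i + 1)) {i m : ℕ} (him : i + m ≤ k) :
    m * d ≤ x (i + m) - x i := by
  induction m with
  | zero => simp
  | succ m ih =>
    have h1 := ih (by lia)
    have h2 := hgap (i + m) (by lia)
    rw [← add_assoc]
    push_cast
    linarith

open Finset in
theorem pow_mul_factorial_le_abs_prod_sub {d : ℝ} (hd : 0 ≤ d) {k : ℕ} {x : ℕ → ℝ}
    (hgap : ∀ i < k, x i + d ≤ x (i + 1)) {i : ℕ} (hi : i ≤ k) :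
    d ^ k * (i.factorial * (k - i).factorial) ≤
      |∏ j ∈ (range (k + 1)).erase i, (x i - x j)| := by
  have hsplit : (range (k + 1)).erase i = range i ∪ Ico (i + 1) (k + 1) := by
    ext j; simp; lia
  have hdisj : Disjoint (range i) (Ico (i + 1) (k + 1)) := by
    rw [disjoint_left]; intro j; simp; lia
  have hleft : d ^ i * i.factorial ≤ ∏ j ∈ range i, |x i - x j| := by
    calc d ^ i * i.factorial = ∏ j ∈ range i, (((j + 1 : ℕ) : ℝ) * d) := by
          rw [prod_mul_distrib, prod_const, card_range, ← Nat.cast_prod,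
            prod_range_add_one_eq_factorial, mul_comm]
      _ ≤ ∏ j ∈ range i, |x i - x (i - 1 - j)| := by
          refine prod_le_prod (fun _ _ => by positivity) fun j hj => ?_
          have hj := mem_range.1 hj
          have := mul_sub_le_sub_of_forall_add_le hgap (i := i - 1 - j) (m := j + 1) (by lia)
          rw [show i - 1 - j + (j + 1) = i by lia] at this
          exact this.trans (le_abs_self _)
      _ = _ := prod_range_reflect (fun j => |x i - x j|) i
  have hright : d ^ (k - i) * (k - i).factorial ≤ ∏ j ∈ Ico (i + 1) (k + 1), |x i - x j| := by
    rw [prod_Ico_eq_prod_range, show k + 1 - (i + 1) = k - i by lia]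
    calc d ^ (k - i) * (k - i).factorial = ∏ j ∈ range (k - i), (((j + 1 : ℕ) : ℝ) * d) := by
          rw [prod_mul_distrib, prod_const, card_range, ← Nat.cast_prod,
            prod_range_add_one_eq_factorial, mul_comm]
      _ ≤ _ := by
          refine prod_le_prod (fun _ _ => by positivity) fun j hj => ?_
          have hj := mem_range.1 hj
          have := mul_sub_le_sub_of_forall_add_le hgap (i := i) (m := j + 1) (by lia)
          rw [abs_sub_comm, show i + 1 + j = i + (j + 1) by lia]
          exact this.trans (le_abs_self _)
  rw [hsplit, prod_union hdisj, abs_mul, abs_prod, abs_prod]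
  calc d ^ k * (i.factorial * (k - i).factorial)
      = d ^ i * i.factorial * (d ^ (k - i) * (k - i).factorial) := by
        rw [← Nat.add_sub_cancel' hi, pow_add]; simp; ring
    _ ≤ _ := mul_le_mul hleft hright (by positivity) (by positivity)

open MeasureTheory in
/-- A set of measure more than `k * d` contains `k + 1` points with consecutive gaps at least `d`. -/
theorem exists_separated_points_of_lt_volume {d : ℝ} (hd : 0 ≤ d) (k : ℕ) {E : Set ℝ}
    (hE : BddBelow E) (hvol : ENNReal.ofReal (k * d) < volume E) :
    ∃ x : ℕ → ℝ, (∀ i ≤ k, x i ∈ E) ∧ ∀ i < k, x i + d ≤ x (i + 1) := by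
  induction k generalizing E with
  | zero =>
    obtain ⟨y, hy⟩ := nonempty_of_measure_ne_zero (ne_bot_of_gt hvol)
    exact ⟨fun _ => y, fun _ _ => hy, by simp⟩
  | succ k ih =>
    have hne : E.Nonempty := nonempty_of_measure_ne_zero (ne_bot_of_gt hvol)
    obtain ⟨r, hr, hrvol⟩ := ENNReal.lt_iff_exists_real_btwn.1 hvol |>.imp fun r hr => hr.2
    have hlt : (k + 1) * d < r := by
      have := (ENNReal.ofReal_lt_ofReal_iff_of_nonneg (by positivity)).1 hr
      exact_mod_cast this
    obtain ⟨y, hyE, hy⟩ := exists_lt_of_csInf_lt hne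
      (show sInf E < sInf E + (r - (k + 1) * d) by linarith)
    have hcover : E ⊆ Set.Ico (sInf E) (y + d) ∪ E ∩ Set.Ici (y + d) := fun t ht => by
      rcases lt_or_ge t (y + d) with h | h
      · exact .inl ⟨csInf_le hE ht, h⟩
      · exact .inr ⟨ht, h⟩
    have hvol' : ENNReal.ofReal (k * d) < volume (E ∩ Set.Ici (y + d)) := by
      by_contra! hle
      have h1 := (measure_mono hcover).trans (measure_union_le (μ := volume) _ _)
      rw [Real.volume_Ico] at h1
      have hyi : sInf E ≤ y := csInf_le hE hyE
      have h2 := (hrvol.trans_le h1).trans_le (add_le_add le_rfl hle)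
      rw [← ENNReal.ofReal_add (by linarith) (by positivity)] at h2
      have h3 := (ENNReal.ofReal_lt_ofReal_iff'.1 h2).1
      linarith
    obtain ⟨x, hxE, hgap⟩ := ih (hE.mono Set.inter_subset_left) hvol'
    refine ⟨fun i => Nat.casesOn i y x, fun i hi => ?_, fun i hi => ?_⟩
    · cases i with
      | zero => exact hyE
      | succ i => exact (hxE i (by lia)).1
    · cases i with
      | zero => exact (hxE 0 (by lia)).2
      | succ i => exact hgap i (by lia)

open Finset in
theorem mul_pow_le_of_separated_points {a b C δ d : ℝ} {k : ℕ} {f : ℝ → ℝ} {x : ℕ → ℝ}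
    (hf : ContDiffOn ℝ k f (Set.Ioo a b))
    (hC : ∀ t ∈ Set.Ioo a b, C ≤ |iteratedDerivWithin k f (Set.Ioo a b) t|) (hd : 0 < d)
    (hx : ∀ i ≤ k, x i ∈ Set.Ioo a b) (hδ : ∀ i ≤ k, |f (x i)| ≤ δ)
    (hgap : ∀ i < k, x i + d ≤ x (i + 1)) :
    C * d ^ k ≤ 2 ^ k * δ := by
  have hδ0 : 0 ≤ δ := (abs_nonneg _).trans (hδ 0 (by lia))
  have hmono : ∀ i j, i < j → j ≤ k → x i < x j := fun i j hij hj => by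
    have h := mul_sub_le_sub_of_forall_add_le hgap (i := i) (m := j - i) (by lia)
    rw [Nat.add_sub_cancel' hij.le] at h
    have : (0 : ℝ) < (j - i : ℕ) * d := by
      have : (0 : ℝ) < (j - i : ℕ) := by exact_mod_cast Nat.sub_pos_of_lt hij
      positivity
    linarith
  have hinj : Set.InjOn x (range (k + 1)) := by
    intro i hi j hj hij
    simp only [coe_range, Set.mem_Iio] at hi hj
    rcases lt_trichotomy i j with h | h | h
    · exact absurd hij (hmono i j h (by lia)).ne
    · exact h
    · exact absurd hij (hmono j i h (by lia)).ne'
  obtain ⟨ξ, hξ, heq⟩ := exists_iteratedDerivWithin_eq_factorial_mul_sum k hf hx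
    (fun i hi => hmono i (i + 1) (by lia) hi) hinj
  have hterm : ∀ i ∈ range (k + 1),
      |f (x i) / ∏ j ∈ (range (k + 1)).erase i, (x i - x j)| ≤
        δ / (d ^ k * k.factorial) * k.choose i := by
    intro i hi
    have hi : i ≤ k := by simpa [Nat.lt_succ_iff] using hi
    rw [abs_div, Nat.cast_choose ℝ hi]
    calc _ ≤ δ / (d ^ k * (i.factorial * (k - i).factorial)) :=
          div_le_div₀ hδ0 (hδ i hi) (by positivity)
            (pow_mul_factorial_le_abs_prod_sub hd.le hgap hi)
      _ = _ := by field_simp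
  have hsum := (abs_sum_le_sum_abs _ _).trans (sum_le_sum hterm)
  rw [← mul_sum, ← Nat.cast_sum, Nat.sum_range_choose] at hsum
  have hCξ := hC ξ hξ
  rw [heq, abs_mul, Nat.abs_cast] at hCξ
  have hk : (0 : ℝ) < k.factorial := by positivity
  calc C * d ^ k ≤ k.factorial * (δ / (d ^ k * k.factorial) * (2 ^ k : ℕ)) * d ^ k := by
        gcongr
        exact hCξ.trans (by gcongr)
    _ = _ := by push_cast; field_simp

theorem statement14 (k : ℕ) (hk : 1 ≤ k) (a b : ℝ) (h : ℝ → ℝ)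
    (hcont : ContDiffOn ℝ k h (Set.Ioo a b)) (C : ℝ) (hC : 0 < C)
    (hder : ∀ x ∈ Set.Ioo a b, C ≤ |iteratedDerivWithin k h (Set.Ioo a b) x|)
    (δ : ℝ) (hδ : 0 < δ) :
    MeasureTheory.volume {x ∈ Set.Ioo a b | |h x| ≤ δ} ≤
      ENNReal.ofReal (2 * Real.exp 1 * ((k + 1).factorial : ℝ) ^ ((1 : ℝ) / k) *
        (δ / C) ^ ((1 : ℝ) / k)) := by
  set M := 2 * Real.exp 1 * ((k + 1).factorial : ℝ) ^ ((1 : ℝ) / k) * (δ / C) ^ ((1 : ℝ) / k)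
    with hM
  have hk0 : k ≠ 0 := by lia
  have hkpos : (0 : ℝ) < k := by exact_mod_cast hk
  have hMpos : 0 < M := by positivity
  have hMpow : M ^ k = 2 ^ k * Real.exp 1 ^ k * (k + 1).factorial * (δ / C) := by
    rw [hM, one_div, mul_pow, mul_pow, mul_pow, Real.rpow_inv_natCast_pow (by positivity) hk0,
      Real.rpow_inv_natCast_pow (by positivity) hk0]
  by_contra! hlt
  obtain ⟨x, hxE, hgap⟩ := exists_separated_points_of_lt_volume (d := M / k) (by positivity) k
    (bddBelow_Ioo.mono (Set.sep_subset _ _)) (by rwa [mul_div_cancel₀ _ hkpos.ne'])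
  have hle := mul_pow_le_of_separated_points hcont hder (by positivity)
    (fun i hi => (hxE i hi).1) (fun i hi => (hxE i hi).2) hgap
  rw [div_pow, hMpow] at hle
  have hexp : (k : ℝ) ^ k < Real.exp 1 ^ k * (k + 1).factorial := by
    have h1 := Real.pow_div_factorial_le_exp k hkpos.le k
    rw [div_le_iff₀ (by positivity), ← Real.exp_one_pow] at h1
    refine h1.trans_lt ?_
    gcongr
    exact Nat.lt_succ_self k
  have hle' : Real.exp 1 ^ k * (k + 1).factorial ≤ (k : ℝ) ^ k := by
    have : C * (2 ^ k * Real.exp 1 ^ k * (k + 1).factorial * (δ / C) / k ^ k) =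
        2 ^ k * δ * (Real.exp 1 ^ k * (k + 1).factorial / k ^ k) := by field_simp
    rw [this] at hle
    exact (div_le_one (by positivity)).1 (le_of_mul_le_mul_left (by simpa using hle)
      (show 0 < 2 ^ k * δ by positivity))
  exact hle'.not_gt hexp
end

section
/- Let g ∈ ℝ[x,y] be an absolutely irreducible polynomial of degree d ≥ 2, let I ⊆ ℝ be a non-degenerate interval, and suppose h ∈ C^∞(I) satisfies g(x, h(x)) = 0 for all x ∈ I. Then for every a ∈ I there exists an integer e with 1 ≤ e ≤ d such that h^{(e)}(a) ≠ 0. -/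
open Filter Topology Asymptotics in
theorem Polynomial.eq_zero_of_natDegree_le_of_isLittleO {p : Polynomial ℝ} {n : ℕ}
    (hp : p.natDegree ≤ n) {a : ℝ} {l : Filter ℝ} [l.NeBot] (hl : l ≤ 𝓝[≠] a)
    (h : (fun x ↦ p.eval x) =o[l] fun x ↦ (x - a) ^ n) : p = 0 := by
  by_contra hp0
  obtain ⟨q, hpq, hq⟩ := Polynomial.exists_eq_pow_rootMultiplicity_mul_and_not_dvd p hp0 a
  set m := p.rootMultiplicity a
  have hmn : m ≤ n := by
    refine le_trans ?_ hp
    simpa using Polynomial.natDegree_le_of_dvd (Polynomial.pow_rootMultiplicity_dvd p a) hp0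
  have hla : l ≤ 𝓝 a := hl.trans nhdsWithin_le_nhds
  have h_ne : ∀ᶠ x in l, x - a ≠ 0 := by
    filter_upwards [hl self_mem_nhdsWithin] with x hx
    exact sub_ne_zero.mpr hx
  have h_pow : (fun x : ℝ ↦ (x - a) ^ n) =O[l] fun x ↦ (x - a) ^ m := by
    have h_bdd : (fun x : ℝ ↦ (x - a) ^ (n - m)) =O[l] fun _ ↦ (1 : ℝ) :=
      ((Continuous.tendsto (by fun_prop) a).mono_left hla).isBigO_one ℝ
    refine (h_bdd.mul (isBigO_refl (fun x : ℝ ↦ (x - a) ^ m) l)).congr (fun x ↦ ?_) fun x ↦ ?_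
    · rw [← pow_add, Nat.sub_add_cancel hmn]
    · rw [one_mul]
  have h_lim : Tendsto (fun x ↦ q.eval x) l (𝓝 0) := by
    refine (h.trans_isBigO h_pow).tendsto_div_nhds_zero.congr' ?_
    filter_upwards [h_ne] with x hx
    rw [hpq, Polynomial.eval_mul, Polynomial.eval_pow, Polynomial.eval_sub, Polynomial.eval_X,
      Polynomial.eval_C, mul_div_cancel_left₀ _ (pow_ne_zero m hx)]
  exact hq (Polynomial.dvd_iff_isRoot.mpr
    (tendsto_nhds_unique ((q.continuous.tendsto a).mono_left hla) h_lim))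

/-- Reducing a bivariate polynomial modulo `y - c` amounts to substituting `c` for `y`. -/
theorem MvPolynomial.X_sub_C_dvd_sub_aeval_aeval {R : Type*} [CommRing R]
    (g : MvPolynomial (Fin 2) R) (c : R) :
    (X 1 - C c : MvPolynomial (Fin 2) R) ∣
      g - Polynomial.aeval (X 0) (aeval ![Polynomial.X, Polynomial.C c] g) := by
  rw [← Ideal.mem_span_singleton, ← Ideal.Quotient.mk_eq_mk_iff_sub_mem]
  set J : Ideal (MvPolynomial (Fin 2) R) := Ideal.span {X 1 - C c}
  have h_eq : Ideal.Quotient.mkₐ R J = ((Ideal.Quotient.mkₐ R J).comp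
      (Polynomial.aeval (X 0))).comp (aeval ![Polynomial.X, Polynomial.C c]) := by
    refine MvPolynomial.algHom_ext fun i ↦ ?_
    fin_cases i
    · simp
    · simpa using Ideal.Quotient.mk_eq_mk_iff_sub_mem _ _ |>.mpr
        (Ideal.mem_span_singleton_self (X 1 - C c : MvPolynomial (Fin 2) R))
  exact DFunLike.congr_fun h_eq g

theorem MvPolynomial.totalDegree_le_one_of_irreducible_of_X_sub_C_dvd {K : Type*} [Field K]
    {g : MvPolynomial (Fin 2) K} (hg : Irreducible g) {c : K} (h : X 1 - C c ∣ g) :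
    g.totalDegree ≤ 1 := by
  obtain ⟨r, rfl⟩ := h
  rcases hg.isUnit_or_isUnit rfl with h_unit | h_unit
  · simpa using h_unit.map (eval ![0, c])
  · have h_r := (isUnit_iff_totalDegree_of_isReduced.mp h_unit).2
    refine (totalDegree_mul _ _).trans ?_
    rw [h_r, add_zero]
    refine (totalDegree_sub _ _).trans ?_
    simp

open Filter Topology Asymptotics Set in
theorem isLittleO_sub_of_iteratedDerivWithin_eq_zero {f : ℝ → ℝ} {s : Set ℝ} {a : ℝ} {n : ℕ}
    (hs : Convex ℝ s) (ha : a ∈ s) (hf : ContDiffOn ℝ n f s)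
    (h : ∀ e, 1 ≤ e → e ≤ n → iteratedDerivWithin e f s a = 0) :
    (fun x ↦ f x - f a) =o[𝓝[s] a] fun x ↦ (x - a) ^ n := by
  refine (taylor_isLittleO hs ha hf).congr_left fun x ↦ ?_
  rw [taylor_within_apply, Finset.sum_eq_single 0]
  · simp
  · intro k hk hk0
    rw [h k (Nat.one_le_iff_ne_zero.mpr hk0) (Nat.lt_succ_iff.mp (Finset.mem_range.mp hk)),
      smul_zero]
  · simp

open Filter Topology Asymptotics Set in
theorem statement16 (g : MvPolynomial (Fin 2) ℝ) (d : ℕ) (hd : 2 ≤ d)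
    (hdeg : g.totalDegree = d)
    (hirr : Irreducible (MvPolynomial.map (algebraMap ℝ ℂ) g))
    (u v : ℝ) (huv : u < v) (h : ℝ → ℝ)
    (hsm : ContDiffOn ℝ (⊤ : ℕ∞) h (Set.Icc u v))
    (hcurve : ∀ x ∈ Set.Icc u v, MvPolynomial.eval ![x, h x] g = 0)
    (a : ℝ) (ha : a ∈ Set.Icc u v) :
    ∃ e : ℕ, 1 ≤ e ∧ e ≤ d ∧ iteratedDerivWithin e h (Set.Icc u v) a ≠ 0 := by
  by_contra! h_zero
  have h_flat := isLittleO_sub_of_iteratedDerivWithin_eq_zero (convex_Icc u v) ha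
    (hsm.of_le (by exact_mod_cast le_top)) h_zero
  obtain ⟨r, hr⟩ := g.X_sub_C_dvd_sub_aeval_aeval (h a)
  set p : Polynomial ℝ := MvPolynomial.aeval ![Polynomial.X, Polynomial.C (h a)] g
  have h_deg : p.natDegree ≤ d := by
    simpa using MvPolynomial.aeval_natDegree_le (n := 1) g hdeg.le
      ![Polynomial.X, Polynomial.C (h a)] (by intro i; fin_cases i <;> simp)
  have h_eval : ∀ x ∈ Icc u v,
      (h x - h a) * -MvPolynomial.eval ![x, h x] r = p.eval x := by
    intro x hx
    have h_ev := congrArg (MvPolynomial.eval ![x, h x]) hr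
    have h_p : MvPolynomial.eval ![x, h x] (Polynomial.aeval (MvPolynomial.X 0) p) = p.eval x := by
      rw [← MvPolynomial.coe_aeval_eq_eval, RingHom.coe_coe, ← Polynomial.aeval_algHom_apply]
      simp
    simp only [map_sub, map_mul, hcurve x hx, h_p, MvPolynomial.eval_X, MvPolynomial.eval_C,
      Matrix.cons_val_one, Matrix.cons_val_zero] at h_ev
    linarith
  have h_bdd : (fun x ↦ -MvPolynomial.eval ![x, h x] r) =O[𝓝[Icc u v] a] fun _ ↦ (1 : ℝ) := by
    have h_cont : ContinuousOn (fun x ↦ ![x, h x]) (Icc u v) := by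
      refine continuousOn_pi.mpr fun i ↦ ?_
      fin_cases i
      · exact continuousOn_id
      · exact hsm.continuousOn
    exact (((MvPolynomial.continuous_eval r).comp_continuousOn h_cont).neg a ha).isBigO_one ℝ
  have h_small : (fun x ↦ p.eval x) =o[𝓝[Icc u v] a] fun x ↦ (x - a) ^ d := by
    refine (h_flat.mul_isBigO h_bdd).congr' ?_ (by simp)
    filter_upwards [self_mem_nhdsWithin] with x hx using h_eval x hx
  have h_nebot : (𝓝[Icc u v \ {a}] a).NeBot := by
    have h_acc := (isPreconnected_Icc (a := u) (b := v)).preperfect_of_nontrivial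
      ⟨u, left_mem_Icc.mpr huv.le, v, right_mem_Icc.mpr huv.le, huv.ne⟩ a ha
    rwa [accPt_principal_iff_nhdsWithin] at h_acc
  have h_p0 : p = 0 := Polynomial.eq_zero_of_natDegree_le_of_isLittleO h_deg
    (l := 𝓝[Icc u v \ {a}] a) (nhdsWithin_mono a fun _ hx ↦ hx.2)
    (h_small.mono (nhdsWithin_mono a sdiff_subset))
  rw [h_p0, map_zero, sub_zero] at hr
  have h_le := MvPolynomial.totalDegree_le_one_of_irreducible_of_X_sub_C_dvd hirr
    (c := (h a : ℂ)) ⟨MvPolynomial.map (algebraMap ℝ ℂ) r, by rw [hr]; simp⟩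
  rw [MvPolynomial.totalDegree,
    MvPolynomial.support_map_of_injective _ (algebraMap ℝ ℂ).injective,
    ← MvPolynomial.totalDegree] at h_le
  omega
end
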